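/- arXiv:2204.04624 — 9 statements merged into one kernel-verified Lean document; each statement's English description precedes it below -/
import Mathlib

section
/- Let q ≥ 3 be an integer and A a subset of {0,1,...,q-1} with 1 < #A < q, and let K(q,A) = { Σ_{i=1}^∞ d_i/q^i : d_i ∈ A for all i ∈ ℕ }. If p ≥ 2 is an integer with gcd(p,q) = 1, then the intersection D_p ∩ K(q,A) is a finite set, where D_p = { Σ_{i=1}^n d_i/p^i : d_i ∈ {0,1,...,p-1} for all 1 ≤ i ≤ n, n ∈ ℕ } is the set of rationals in [0,1] admitting a finite p-adic expansion. -/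
/-- `K q A` is the set of reals `∑_{i=1}^∞ d_i / q^i` with all digits `d_i ∈ A`. -/
def K (q : ℕ) (A : Finset ℕ) : Set ℝ :=
  {x | ∃ d : ℕ → ℕ, (∀ i, d i ∈ A) ∧ x = ∑' i : ℕ, (d i : ℝ) / (q : ℝ) ^ (i + 1)}

/-- `D p` is the set of rationals in `[0,1]` with a finite `p`-adic expansion,
i.e. numbers of the form `a / p^n` with `a ≤ p^n`. -/
def D (p : ℕ) : Set ℝ :=
  {x | ∃ a n : ℕ, a ≤ p ^ n ∧ x = (a : ℝ) / (p : ℝ) ^ n}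

theorem one_add_pow_expand (y : ℤ) (n : ℕ) :
    ∃ z : ℤ, (1 + y) ^ n = 1 + n * y + y ^ 2 * z := by
  induction n with
  | zero => exact ⟨0, by simp⟩
  | succ n ih =>
    obtain ⟨z, hz⟩ := ih
    exact ⟨n + z + y * z, by rw [pow_succ, hz]; push_cast; ring⟩

/-- If every prime factor of `n` divides `B - 1`, then `n` divides `B ^ n - 1`. -/
theorem dvd_pow_self_sub_one (B : ℤ) (n : ℕ)
    (h : ∀ l : ℕ, l.Prime → l ∣ n → (l : ℤ) ∣ B - 1) : (n : ℤ) ∣ B ^ n - 1 := by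
  induction n using induction_on_primes with
  | zero => simp
  | one => simp
  | prime_mul l m hl ih =>
    obtain ⟨c, hc⟩ := ih fun l' hl' hd => h l' hl' (hd.mul_left l)
    obtain ⟨c', hc'⟩ : (l : ℤ) ∣ B ^ m - 1 :=
      (h l hl (dvd_mul_right l m)).trans (sub_one_dvd_pow_sub_one B m)
    obtain ⟨z, hz⟩ := one_add_pow_expand (B ^ m - 1) l
    have hB : B ^ (l * m) = (1 + (B ^ m - 1)) ^ l := by
      rw [mul_comm, pow_mul]; congr 1; ring
    refine ⟨c + c' * c * z, ?_⟩
    rw [hB, hz]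
    push_cast
    linear_combination (l : ℤ) * hc + (B ^ m - 1) * z * hc' + l * c' * z * hc

theorem exists_pow_pow_eq (r f : ℕ) (hf : 2 ≤ f) (w : ℤ)
    (hw : ¬ (r : ℤ) ∣ w) (t : ℕ) :
    ∃ w' : ℤ, (1 + (r : ℤ) ^ f * w) ^ r ^ t = 1 + (r : ℤ) ^ (f + t) * w' ∧ ¬ (r : ℤ) ∣ w' := by
  induction t with
  | zero => exact ⟨w, by simp, hw⟩
  | succ t ih =>
    obtain ⟨v, hv, hrv⟩ := ih
    obtain ⟨z, hz⟩ := one_add_pow_expand ((r : ℤ) ^ (f + t) * v) r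
    obtain ⟨g, hg⟩ := Nat.exists_eq_add_of_le hf
    refine ⟨v + r * (r ^ (g + t) * v ^ 2 * z), ?_, ?_⟩
    · rw [pow_succ, pow_mul, hv, hz, hg]
      ring
    · rwa [dvd_add_left (dvd_mul_right _ _)]

theorem exists_pow_coprime_eq (r : ℕ) (hr : r.Prime) (f : ℕ) (hf : 1 ≤ f) (w : ℤ)
    (hw : ¬ (r : ℤ) ∣ w) (c : ℕ) (hc : ¬ r ∣ c) :
    ∃ w' : ℤ, (1 + (r : ℤ) ^ f * w) ^ c = 1 + (r : ℤ) ^ f * w' ∧ ¬ (r : ℤ) ∣ w' := by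
  obtain ⟨z, hz⟩ := one_add_pow_expand ((r : ℤ) ^ f * w) c
  obtain ⟨g, hg⟩ := Nat.exists_eq_add_of_le hf
  refine ⟨c * w + r * (r ^ g * w ^ 2 * z), ?_, ?_⟩
  · rw [hz, hg]; ring
  · rw [dvd_add_left (dvd_mul_right _ _), (Nat.prime_iff_prime_int.mp hr).dvd_mul, not_or]
    exact ⟨by exact_mod_cast hc, hw⟩

/-- Some power of `q` is congruent to `1` modulo `r ^ t * c` with exact `r`-adic valuation `t`. -/
theorem exists_pow_eq_one_add (q p r c t n : ℕ) (hq : 2 ≤ q) (hp : 2 ≤ p)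
    (hpq : Nat.Coprime p q) (hr : r.Prime) (hrp : r ∣ p) (hc : c ∣ p ^ n) (hrc : ¬ r ∣ c)
    (ht : q ^ (p ^ 2).totient ≤ t) :
    ∃ k : ℕ, ∃ u : ℤ, (q : ℤ) ^ k = 1 + (r : ℤ) ^ t * c * u ∧ ¬ (r : ℤ) ∣ u := by
  set M := (p ^ 2).totient
  have hM0 : M ≠ 0 := (Nat.totient_pos.2 (by positivity)).ne'
  have hB1 : 1 < q ^ M := Nat.one_lt_pow hM0 (by omega)
  have hmod : p ^ 2 ∣ q ^ M - 1 :=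
    (Nat.modEq_iff_dvd' hB1.le).1 (Nat.ModEq.pow_totient (Nat.Coprime.pow_right 2 hpq.symm)).symm
  obtain ⟨f, w, hw, hfw⟩ := Nat.exists_eq_pow_mul_and_not_dvd
    (n := q ^ M - 1) (by omega) r hr.ne_one
  have hf2 : 2 ≤ f := by
    by_contra hlt
    have h1 : r ^ 2 ∣ r ^ f * w := hfw ▸ (pow_dvd_pow_of_dvd hrp 2).trans hmod
    have h2 : r ^ f * r ∣ r ^ f * w := by
      rw [← pow_succ]
      exact (pow_dvd_pow r (by omega)).trans h1
    exact hw (Nat.dvd_of_mul_dvd_mul_left (pow_pos hr.pos f) h2)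
  have hft : f ≤ t := by
    have h1 : r ^ f ≤ q ^ M - 1 := Nat.le_of_dvd (by omega) (hfw ▸ dvd_mul_right _ _)
    have h2 : f < r ^ f := Nat.lt_pow_self hr.one_lt
    omega
  have hB : (q : ℤ) ^ M = 1 + (r : ℤ) ^ f * w := by
    have : q ^ M = 1 + r ^ f * w := by omega
    exact_mod_cast this
  obtain ⟨v, hv, hrv⟩ := exists_pow_coprime_eq r hr f (by omega) w (by exact_mod_cast hw) c hrc
  obtain ⟨v', hv', hrv'⟩ := exists_pow_pow_eq r f hf2 v hrv (t - f)
  rw [Nat.add_sub_cancel' hft, ← hv, ← hB] at hv'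
  have hcd : (c : ℤ) ∣ ((q : ℤ) ^ M) ^ c - 1 := by
    refine dvd_pow_self_sub_one _ _ fun l hl hlc => ?_
    have h1 : l ∣ p := hl.dvd_of_dvd_pow (hlc.trans hc)
    have h2 : l ∣ q ^ M - 1 := (h1.trans (dvd_pow_self p two_ne_zero)).trans hmod
    have h3 := Int.natCast_dvd_natCast.2 h2
    rwa [Nat.cast_sub hB1.le, Nat.cast_pow, Nat.cast_one] at h3
  have hcd' : (c : ℤ) ∣ (r : ℤ) ^ t * v' := by
    have := hcd.trans (sub_one_dvd_pow_sub_one (((q : ℤ) ^ M) ^ c) (r ^ (t - f)))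
    rwa [hv', add_sub_cancel_left] at this
  have hcop : IsCoprime (c : ℤ) ((r : ℤ) ^ t) := by
    have : Nat.Coprime c (r ^ t) := Nat.Coprime.pow_right t ((hr.coprime_iff_not_dvd.2 hrc).symm)
    exact_mod_cast Nat.isCoprime_iff_coprime.2 this
  obtain ⟨u, hu⟩ := hcop.dvd_of_dvd_mul_left hcd'
  refine ⟨M * c * r ^ (t - f), u, ?_, fun h => hrv' (hu ▸ h.mul_left _)⟩
  rw [pow_mul, pow_mul, hv', hu]
  ring

theorem summable_digits (q : ℕ) (hq : 2 ≤ q) (d : ℕ → ℕ) (hd : ∀ i, d i < q) :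
    Summable fun i : ℕ => (d i : ℝ) / (q : ℝ) ^ (i + 1) := by
  have hq0 : (0 : ℝ) < q := by positivity
  refine Summable.of_nonneg_of_le (fun i => by positivity) (fun i => ?_)
    (summable_geometric_of_lt_one (r := (q : ℝ)⁻¹) (by positivity)
      (inv_lt_one_of_one_lt₀ (by exact_mod_cast hq)))
  rw [inv_pow, div_le_iff₀ (by positivity), pow_succ, inv_mul_cancel_left₀ (by positivity)]
  exact_mod_cast (hd i).le

theorem tsum_digits_le_one (q : ℕ) (hq : 2 ≤ q) (d : ℕ → ℕ) (hd : ∀ i, d i < q) :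
    ∑' i : ℕ, (d i : ℝ) / (q : ℝ) ^ (i + 1) ≤ 1 := by
  have hq1 : (1 : ℝ) < q := by exact_mod_cast hq
  have hq0 : (0 : ℝ) < q := by positivity
  have hg := (hasSum_geometric_of_lt_one (r := (q : ℝ)⁻¹) (by positivity)
    (inv_lt_one_of_one_lt₀ hq1)).mul_left (((q : ℝ) - 1) / q)
  have h1 : ((q : ℝ) - 1) / q * (1 - (q : ℝ)⁻¹)⁻¹ = 1 := by
    have : (q : ℝ) - 1 ≠ 0 := by linarith
    field_simp
  rw [h1] at hg
  refine hasSum_le (fun i => ?_) (summable_digits q hq d hd).hasSum hg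
  have h2 : (d i : ℝ) + 1 ≤ q := by exact_mod_cast hd i
  rw [inv_pow, pow_succ', div_mul_eq_mul_div, ← div_eq_mul_inv, div_div, mul_comm (q : ℝ)]
  gcongr
  linarith

/-- The integer part of `q ^ (k + 1) * x` is congruent to the `k`-th digit modulo `q`. -/
theorem exists_int_near_pow_mul (q : ℕ) (hq : 2 ≤ q) (d : ℕ → ℕ) (hd : ∀ i, d i < q) (k : ℕ) :
    ∃ m : ℤ, ((q * m + d k : ℤ) : ℝ)
        ≤ (q : ℝ) ^ (k + 1) * ∑' i : ℕ, (d i : ℝ) / (q : ℝ) ^ (i + 1) ∧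
      (q : ℝ) ^ (k + 1) * ∑' i : ℕ, (d i : ℝ) / (q : ℝ) ^ (i + 1)
        ≤ ((q * m + d k : ℤ) : ℝ) + 1 := by
  have hq0 : (0 : ℝ) < q := by positivity
  have step : ∀ e : ℕ → ℕ, (∀ i, e i < q) →
      (q : ℝ) * ∑' i : ℕ, (e i : ℝ) / (q : ℝ) ^ (i + 1)
        = e 0 + ∑' i : ℕ, (e (i + 1) : ℝ) / (q : ℝ) ^ (i + 1) := by
    intro e he
    rw [(summable_digits q hq e he).tsum_eq_zero_add, mul_add, ← tsum_mul_left]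
    congr 1
    · field_simp
      ring
    · congr 1
      ext i
      field_simp
      ring
  induction k generalizing d with
  | zero =>
    refine ⟨0, ?_⟩
    rw [zero_add, pow_one, step d hd]
    have h0 : 0 ≤ ∑' i : ℕ, (d (i + 1) : ℝ) / (q : ℝ) ^ (i + 1) :=
      tsum_nonneg fun i => by positivity
    have h1 := tsum_digits_le_one q hq (fun i => d (i + 1)) fun i => hd _
    push_cast
    constructor <;> linarith
  | succ k ih =>
    obtain ⟨m, h1, h2⟩ := ih (fun i => d (i + 1)) fun i => hd _
    refine ⟨q ^ k * d 0 + m, ?_⟩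
    rw [pow_succ (q : ℝ) (k + 1), mul_assoc, step d hd]
    push_cast at h1 h2 ⊢
    constructor
    · linear_combination h1
    · linear_combination h2

/-- No `q ^ k * x` with `x ∈ K q A` lies, modulo `1`, inside the gap of a missing digit. -/
theorem not_mem_gap (q : ℕ) (hq : 2 ≤ q) (A : Finset ℕ) (hA : A ⊆ Finset.range q) (b : ℕ)
    (hb : b < q) (hbA : b ∉ A) (x : ℝ) (hx : x ∈ K q A) (k : ℕ) (m : ℤ)
    (h1 : (m : ℝ) + b / q < (q : ℝ) ^ k * x) (h2 : (q : ℝ) ^ k * x < m + (b + 1) / q) :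
    False := by
  obtain ⟨d, hd, rfl⟩ := hx
  have hdq : ∀ i, d i < q := fun i => Finset.mem_range.1 (hA (hd i))
  obtain ⟨m', h3, h4⟩ := exists_int_near_pow_mul q hq d hdq k
  set x := ∑' i : ℕ, (d i : ℝ) / (q : ℝ) ^ (i + 1)
  have hq0 : (0 : ℝ) < q := by positivity
  have h5 : (((q : ℤ) * m + b : ℤ) : ℝ) < (q : ℝ) ^ (k + 1) * x := by
    have := mul_lt_mul_of_pos_left h1 hq0
    rw [mul_add, mul_div_cancel₀ _ hq0.ne'] at this
    push_cast
    rw [pow_succ]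
    linarith
  have h6 : (q : ℝ) ^ (k + 1) * x < (((q : ℤ) * m + b : ℤ) : ℝ) + 1 := by
    have := mul_lt_mul_of_pos_left h2 hq0
    rw [mul_add, mul_div_cancel₀ _ hq0.ne'] at this
    push_cast
    rw [pow_succ]
    linarith
  have h7 : (q : ℤ) * m' + d k < q * m + b + 1 := by exact_mod_cast h3.trans_lt h6
  have h8 : (q : ℤ) * m + b < q * m' + d k + 1 := by exact_mod_cast h5.trans_le h4
  have h9 : (q : ℤ) * m' + d k = q * m + b := by omega
  have h10 : ((q : ℤ) * m' + d k) % q = (q * m + b) % q := by rw [h9]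
  rw [Int.mul_add_emod_self_left, Int.mul_add_emod_self_left] at h10
  have h11 : d k % q = b % q := by exact_mod_cast h10
  rw [Nat.mod_eq_of_lt (hdq k), Nat.mod_eq_of_lt hb] at h11
  exact hbA (h11 ▸ hd k)

/-- If the powers of `q` modulo `R * P` contain `1 + P * u` with `a * u` invertible modulo `R`,
and `R ∣ P`, `q < R`, then the orbit of `a / (R * P)` enters every gap. -/
theorem exists_pow_mul_mem_gap (q b R P k : ℕ) (hq : 0 < q) (hR : q < R) (hP : 0 < P)
    (hRP : R ∣ P) (a u : ℤ) (hk : (q : ℤ) ^ k = 1 + P * u) (hau : IsCoprime (a * u) (R : ℤ)) :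
    ∃ k' : ℕ, ∃ m : ℤ, (m : ℝ) + b / q < (q : ℝ) ^ k' * (a / ((R : ℝ) * P)) ∧
      (q : ℝ) ^ k' * (a / ((R : ℝ) * P)) < m + (b + 1) / q := by
  have hR0 : (0 : ℝ) < R := by exact_mod_cast hq.trans hR
  have hP0 : (0 : ℝ) < P := by exact_mod_cast hP
  have hq0 : (0 : ℝ) < q := by exact_mod_cast hq
  set y : ℝ := a / ((R : ℝ) * P) with hy
  set i : ℤ := ⌊(R : ℝ) * (b / q - y)⌋ + 1 with hi
  obtain ⟨j, c, hj⟩ : ∃ j : ℕ, ∃ c : ℤ, j * (a * u) = i + R * c := by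
    obtain ⟨v, v', hv⟩ := hau
    have hRz : (0 : ℤ) < R := by exact_mod_cast hq.trans hR
    refine ⟨((i * v) % R).toNat, -(i * v') - (i * v / R) * (a * u), ?_⟩
    rw [Int.toNat_of_nonneg (Int.emod_nonneg _ hRz.ne'), Int.emod_def]
    linear_combination i * hv
  obtain ⟨z, hz⟩ := one_add_pow_expand (P * u) j
  obtain ⟨g, hg⟩ := hRP
  have hkey : (q : ℝ) ^ (k * j) * y = y + i / R + ((c + g * u ^ 2 * z * a : ℤ) : ℝ) := by
    have h1 : (q : ℤ) ^ (k * j) = 1 + j * (P * u) + (P * u) ^ 2 * z := by rw [pow_mul, hk, hz]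
    have h2 : (q : ℝ) ^ (k * j) = 1 + j * (P * u) + (P * u) ^ 2 * z := by exact_mod_cast h1
    have h3 : (j : ℝ) * (a * u) = i + R * c := by exact_mod_cast hj
    have h4 : (P : ℝ) = R * g := by exact_mod_cast hg
    have h5 : (a : ℝ) = y * (R * P) := by rw [hy]; field_simp
    have h6 : (i : ℝ) / R = (j : ℝ) * (a * u) / R - c := by rw [h3]; field_simp; ring
    rw [h2, h6]
    push_cast
    have h7 : (j : ℝ) * (a * u) / R = j * (P * u) * y := by rw [h5]; field_simp
    have h8 : (P * u) ^ 2 * z * y = g * u ^ 2 * z * a := by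
      rw [h5]
      linear_combination ((P : ℝ) * u ^ 2 * z * y) * h4
    rw [h7]
    linear_combination h8
  refine ⟨k * j, c + g * u ^ 2 * z * a, ?_, ?_⟩
  · have h1 := Int.lt_floor_add_one ((R : ℝ) * (b / q - y))
    have h2 : (R : ℝ) * (b / q - y) < i := by rw [hi]; exact_mod_cast h1
    have h3 : (b : ℝ) / q - y < i / R := by rw [lt_div_iff₀ hR0]; linarith
    rw [hkey]
    linarith
  · have h1 := Int.floor_le ((R : ℝ) * (b / q - y))
    have h2 : (i : ℝ) ≤ (R : ℝ) * (b / q - y) + 1 := by rw [hi]; push_cast; linarith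
    have h3 : (i : ℝ) / R ≤ (b / q - y) + 1 / R := by
      rw [div_le_iff₀ hR0, add_mul, div_mul_cancel₀ _ hR0.ne']; linarith
    have h4 : (1 : ℝ) / R < 1 / q := one_div_lt_one_div_of_lt hq0 (by exact_mod_cast hR)
    rw [hkey, add_div]
    linarith

theorem den_dvd_of_mem (q p : ℕ) (hq : 3 ≤ q) (A : Finset ℕ) (hAq : A ⊆ Finset.range q)
    (hA2 : A.card < q) (hp : 2 ≤ p) (hpq : Nat.Coprime p q) (x : ℚ) (n : ℕ)
    (hn : x.den ∣ p ^ n) (hx : (x : ℝ) ∈ K q A) :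
    x.den ∣ p ^ (q ^ (p ^ 2).totient + 2 * q) := by
  obtain ⟨b, hbq, hbA⟩ : ∃ b ∈ Finset.range q, b ∉ A :=
    Finset.exists_mem_notMem_of_card_lt_card (by simpa using hA2)
  rw [Finset.mem_range] at hbq
  rw [Nat.dvd_iff_prime_pow_dvd_dvd]
  intro r k hr hrk
  rcases Nat.eq_zero_or_pos k with rfl | hk0
  · simp
  have hrp : r ∣ p := hr.dvd_of_dvd_pow (((dvd_pow_self r hk0.ne').trans hrk).trans hn)
  by_cases hkE : k ≤ q ^ (p ^ 2).totient + 2 * q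
  · exact (pow_dvd_pow r hkE).trans (pow_dvd_pow_of_dvd hrp _)
  exfalso
  obtain ⟨e, c, hc, hec⟩ := Nat.exists_eq_pow_mul_and_not_dvd x.den_nz r hr.ne_one
  have hke : k ≤ e := by
    rw [hec] at hrk
    have := Nat.Coprime.dvd_of_dvd_mul_right
      (Nat.Coprime.pow_left k (hr.coprime_iff_not_dvd.2 hc)) hrk
    exact (Nat.pow_dvd_pow_iff_le_right hr.one_lt).1 this
  have hcn : c ∣ p ^ n := (Dvd.intro_left _ hec.symm).trans hn
  have hc0 : 0 < c := Nat.pos_of_ne_zero fun h => hc (h ▸ dvd_zero r)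
  obtain ⟨l, u, hl, hu⟩ := exists_pow_eq_one_add q p r c (e - q) n (by omega) hp hpq hr hrp hcn hc
    (by omega)
  have hrz := Nat.prime_iff_prime_int.mp hr
  have hrx : ¬ (r : ℤ) ∣ x.num := by
    intro h
    have h1 : r ∣ x.num.natAbs := Int.natCast_dvd.1 h
    have h2 : r ∣ x.den := (dvd_pow_self r hk0.ne').trans hrk
    exact hr.one_lt.ne' (Nat.eq_one_of_dvd_coprimes x.reduced h1 h2)
  have hcop : IsCoprime (x.num * u) ((r ^ q : ℕ) : ℤ) := by
    push_cast
    refine IsCoprime.pow_right (IsCoprime.symm ?_)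
    rw [hrz.coprime_iff_not_dvd, hrz.dvd_mul, not_or]
    exact ⟨hrx, hu⟩
  obtain ⟨k', m, h1, h2⟩ := exists_pow_mul_mem_gap q b (r ^ q) (r ^ (e - q) * c) l (by omega)
    (Nat.lt_pow_self hr.one_lt) (Nat.mul_pos (pow_pos hr.pos _) hc0)
    ((pow_dvd_pow r (by omega)).mul_right c) x.num u (by push_cast; exact hl) hcop
  have hxeq : (x : ℝ) = x.num / (((r ^ q : ℕ) : ℝ) * ((r ^ (e - q) * c : ℕ) : ℝ)) := by
    rw [← Nat.cast_mul, ← mul_assoc, ← pow_add, Nat.add_sub_cancel' (by omega), ← hec]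
    exact Rat.cast_def x
  rw [← hxeq] at h1 h2
  exact not_mem_gap q (by omega) A hAq b hbq hbA x hx k' m h1 h2

theorem stmt_0 (q p : ℕ) (hq : 3 ≤ q) (A : Finset ℕ) (hAq : A ⊆ Finset.range q)
    (hA1 : 1 < A.card) (hA2 : A.card < q) (hp : 2 ≤ p) (hpq : Nat.gcd p q = 1) :
    (D p ∩ K q A).Finite := by
  set E := q ^ (p ^ 2).totient + 2 * q
  refine ((Set.finite_Iic (p ^ E)).image fun a : ℕ => (a : ℝ) / (p : ℝ) ^ E).subset ?_
  rintro x ⟨⟨a, n, han, hx⟩, hxK⟩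
  have hp0 : (0 : ℝ) < p := by positivity
  set y : ℚ := (a : ℚ) / ((p ^ n : ℕ) : ℚ) with hy
  have hxy : (y : ℝ) = x := by rw [hx, hy]; push_cast; rfl
  have hden : y.den ∣ p ^ n := by
    have h : y = Rat.divInt (a : ℤ) ((p ^ n : ℕ) : ℤ) := by
      rw [Rat.divInt_eq_div, Int.cast_natCast, Int.cast_natCast]
    rw [h]
    exact Int.natCast_dvd_natCast.1 (Rat.den_dvd _ _)
  obtain ⟨c, hc⟩ := den_dvd_of_mem q p hq A hAq hA2 hp hpq y n hden (hxy ▸ hxK)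
  have hy0 : 0 ≤ y := by positivity
  obtain ⟨s, hs⟩ := Int.eq_ofNat_of_zero_le (Rat.num_nonneg.2 hy0)
  have hxs : x = ((s * c : ℕ) : ℝ) / (p : ℝ) ^ E := by
    have h1 : (y.den : ℝ) ≠ 0 := by exact_mod_cast y.den_nz
    have h2 : (p : ℝ) ^ E = y.den * c := by exact_mod_cast hc
    have h3 : (c : ℝ) ≠ 0 := fun h => by
      rw [h, mul_zero] at h2
      exact (pow_pos hp0 E).ne' h2
    rw [h2, ← hxy, Rat.cast_def, hs]
    push_cast
    field_simp
  refine ⟨s * c, ?_, hxs.symm⟩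
  have hx1 : x ≤ 1 := by
    rw [hx, div_le_one (by positivity)]
    exact_mod_cast han
  rw [hxs, div_le_one (by positivity)] at hx1
  exact_mod_cast hx1
end

section
/- Let q ≥ 3 be an integer and A a subset of {0,1,...,q-1} with 1 < #A < q, and let K(q,A) = { Σ_{i=1}^∞ d_i/q^i : d_i ∈ A for all i ∈ ℕ }. Let p_1, p_2, ..., p_ℓ ≥ 2 be integers with gcd(q, p_1 p_2 ⋯ p_ℓ) = 1. Then for any positive rational number α, the set { (k_1, k_2, ..., k_ℓ) ∈ ℕ_0^ℓ : α/(p_1^{k_1} p_2^{k_2} ⋯ p_ℓ^{k_ℓ}) ∈ K(q,A) } is finite. -/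
theorem emultiplicity_pow_sub_one_of_sq_dvd {p : ℕ} (hp : p.Prime) {Q : ℤ}
    (h : (p : ℤ) ^ 2 ∣ Q - 1) (s : ℕ) :
    emultiplicity (p : ℤ) (Q ^ s - 1) =
      emultiplicity (p : ℤ) (Q - 1) + emultiplicity (p : ℤ) (s : ℤ) := by
  have h1 : (p : ℤ) ∣ Q - 1 := (dvd_pow_self _ two_ne_zero).trans h
  have hQ : ¬ (p : ℤ) ∣ Q := fun hd => by
    have h2 : (p : ℤ) ∣ 1 := by simpa using dvd_sub hd h1
    exact hp.one_lt.ne' (by exact_mod_cast Int.eq_one_of_dvd_one (by positivity) h2)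
  rcases hp.eq_two_or_odd' with rfl | hodd
  · simpa using Int.two_pow_sub_pow' (x := Q) (y := 1) s (by simpa using h) (by simpa using hQ)
  · rw [Int.natCast_emultiplicity]
    simpa using Int.emultiplicity_pow_sub_pow hp hodd (x := Q) (y := 1) h1 hQ s

/-- Lifting the exponent, simultaneously at all primes dividing `N`. -/
theorem dvd_mul_of_dvd_mul_pow_sub_one {N : ℕ} {a Q : ℤ} {s : ℕ}
    (hQ : ∀ p : ℕ, p.Prime → p ∣ N → (p : ℤ) ^ 2 ∣ Q - 1)
    (h : (N : ℤ) ∣ a * (Q ^ s - 1)) : (N : ℤ) ∣ a * ((Q - 1) * s) := by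
  rw [Int.natCast_dvd, Nat.dvd_iff_prime_pow_dvd_dvd]
  intro p k hp hk
  rcases Nat.eq_zero_or_pos k with rfl | hk0
  · simp
  rw [← Int.natCast_dvd]
  have hk' : ((p : ℤ)) ^ k ∣ a * (Q ^ s - 1) :=
    (by exact_mod_cast hk : (p : ℤ) ^ k ∣ (N : ℤ)).trans h
  have hpr : Prime (p : ℤ) := Nat.prime_iff_prime_int.mp hp
  push_cast
  rw [pow_dvd_iff_le_emultiplicity, emultiplicity_mul hpr] at hk' ⊢
  rwa [emultiplicity_mul hpr, ← emultiplicity_pow_sub_one_of_sq_dvd hp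
    (hQ p hp ((dvd_pow_self p hk0.ne').trans hk))]

theorem exists_int_pow_mul_sum_ofDigitsTerm {q : ℕ} (hq : q ≠ 0) (d : ℕ → Fin q) (i : ℕ) :
    ∃ Z : ℤ, (q : ℝ) ^ i * ∑ t ∈ Finset.range i, Real.ofDigitsTerm d t = Z := by
  have hq0 : (q : ℝ) ≠ 0 := by exact_mod_cast hq
  induction i with
  | zero => exact ⟨0, by simp⟩
  | succ i ih =>
    obtain ⟨Z, hZ⟩ := ih
    refine ⟨q * Z + (d i : ℕ), ?_⟩
    rw [Finset.sum_range_succ, mul_add, Real.ofDigitsTerm, pow_succ', mul_assoc, hZ]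
    push_cast
    field_simp

/-- If two blocks of length `n` in the expansion of `a / D` agree and `D < q ^ n`, then the
corresponding remainders agree. -/
theorem dvd_mul_pow_sub_pow_of_digits_eq {q : ℕ} (hq : q ≠ 0) {d : ℕ → Fin q} {a : ℤ}
    {D n i j : ℕ} (hx : (D : ℝ) * Real.ofDigits d = a) (hDn : D < q ^ n)
    (hd : ∀ t < n, d (t + i) = d (t + j)) : (D : ℤ) ∣ a * (q ^ j - q ^ i) := by
  have hq0 : (0 : ℝ) < q := by exact_mod_cast Nat.pos_of_ne_zero hq
  have key (i : ℕ) : ∃ Z : ℤ,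
      (D : ℝ) * Real.ofDigits (fun t => d (t + i)) = (a * q ^ i - D * Z : ℤ) := by
    obtain ⟨Z, hZ⟩ := exists_int_pow_mul_sum_ofDigitsTerm hq d i
    refine ⟨Z, ?_⟩
    push_cast
    rw [← hZ, ← hx, Real.ofDigits_eq_sum_add_ofDigits d i]
    field_simp
    ring
  obtain ⟨Z, hZ⟩ := key i
  obtain ⟨W, hW⟩ := key j
  have habs := Real.abs_ofDigits_sub_ofDigits_le (x := fun t => d (t + i))
    (y := fun t => d (t + j)) hd
  have hlt : |(D : ℝ) * Real.ofDigits (fun t => d (t + i)) -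
      D * Real.ofDigits (fun t => d (t + j))| < 1 := by
    rw [← mul_sub, abs_mul, Nat.abs_cast]
    calc (D : ℝ) * _ ≤ D * ((q : ℝ) ^ n)⁻¹ := by gcongr
      _ < 1 := by
        rw [← div_eq_mul_inv, div_lt_one (by positivity)]
        exact_mod_cast hDn
  rw [hZ, hW, ← Int.cast_sub, ← Int.cast_abs] at hlt
  have h0 : |(a * q ^ i - D * Z) - (a * q ^ j - D * W)| < 1 := by exact_mod_cast hlt
  rw [Int.abs_lt_one_iff] at h0
  exact ⟨W - Z, by linear_combination -h0⟩

theorem exists_forall_mul_pow_lt_pow {r q : ℕ} (hrq : r < q) (E : ℕ) :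
    ∃ M, ∀ n, M ≤ n → E * r ^ n < q ^ n := by
  have hq : (0 : ℝ) < q := by exact_mod_cast (Nat.zero_le r).trans_lt hrq
  obtain ⟨M, hM⟩ := exists_pow_lt_of_lt_one (x := ((E : ℝ) + 1)⁻¹) (by positivity)
    ((div_lt_one hq).2 (Nat.cast_lt.2 hrq))
  refine ⟨M, fun n hn => ?_⟩
  have h1 : ((r : ℝ) / q) ^ n < ((E : ℝ) + 1)⁻¹ :=
    (pow_le_pow_of_le_one (by positivity)
      ((div_le_one hq).2 (Nat.cast_le.2 hrq.le)) hn).trans_lt hM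
  rw [div_pow, div_lt_iff₀ (by positivity), inv_mul_eq_div, lt_div_iff₀ (by positivity)] at h1
  have h2 : r ^ n * (E + 1) < q ^ n := by exact_mod_cast h1
  nlinarith [Nat.zero_le (r ^ n)]

theorem exists_ofDigits_eq_of_mem_K {q : ℕ} {A : Finset ℕ} (hA : A ⊆ Finset.range q) {x : ℝ}
    (hx : x ∈ K q A) : ∃ d : ℕ → Fin q, (∀ i, (d i : ℕ) ∈ A) ∧ Real.ofDigits d = x := by
  obtain ⟨d, hd, rfl⟩ := hx
  exact ⟨fun i => ⟨d i, Finset.mem_range.1 (hA (hd i))⟩, hd, by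
    simp [Real.ofDigits, Real.ofDigitsTerm, div_eq_mul_inv]⟩

/-- If the prime factors of the denominators `N` lie in a fixed finite set of primes not dividing
`q`, only boundedly many fractions `α / N` lie in `K q A`. -/
theorem exists_bound_of_div_mem_K {q : ℕ} (hq : 2 ≤ q) {A : Finset ℕ}
    (hAq : A ⊆ Finset.range q) (hA : A.card < q) {P : ℕ} (hP : P ≠ 0) (hPq : q.Coprime P)
    {α : ℚ} (hα : 0 < α) :
    ∃ B, ∀ N : ℕ, N ≠ 0 → (∀ p : ℕ, p.Prime → p ∣ N → p ∣ P) →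
      (α : ℝ) / N ∈ K q A → N ≤ B := by
  set Q := q ^ (P ^ 2).totient with hQdef
  have hT : 0 < (P ^ 2).totient := Nat.totient_pos.2 (by positivity)
  have hQ1 : 1 < Q := Nat.one_lt_pow hT.ne' hq
  have hPQ : ((P : ℤ)) ^ 2 ∣ (Q : ℤ) - 1 := by
    have := (Nat.modEq_iff_dvd.1 (Nat.ModEq.pow_totient (hPq.pow_right 2)).symm)
    exact_mod_cast this
  have hnum : 0 < α.num := Rat.num_pos.2 hα
  obtain ⟨a, ha⟩ : ∃ a : ℕ, α.num = a := ⟨α.num.toNat, by lia⟩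
  have ha0 : 0 < a := by lia
  set b := α.den with hb
  have hb0 : 0 < b := α.den_pos
  set C := a * (Q - 1) with hC
  have hC0 : 0 < C := Nat.mul_pos ha0 (by lia)
  obtain ⟨M, hM⟩ := exists_forall_mul_pow_lt_pow hA (q * b * C)
  refine ⟨q ^ M, fun N hN hNP hmem => ?_⟩
  obtain ⟨d, hdA, hdx⟩ := exists_ofDigits_eq_of_mem_K hAq hmem
  have hbN : b * N ≠ 0 := by positivity
  set n := Nat.log q (b * N) + 1 with hn
  have hlt : b * N < q ^ n := Nat.lt_pow_succ_log_self (by lia) _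
  have hle : q ^ n ≤ q * (b * N) := by
    rw [hn, pow_succ']
    exact Nat.mul_le_mul_left _ (Nat.pow_log_le_self q hbN)
  have hNC : Nat.Coprime N q := Nat.coprime_of_dvd fun p hp h1 h2 =>
    hp.one_lt.ne' (Nat.dvd_one.1 (hPq ▸ Nat.dvd_gcd h2 (hNP p hp h1)))
  have hx : ((b * N : ℕ) : ℝ) * Real.ofDigits d = (a : ℤ) := by
    have h1 : (α : ℝ) = a / b := by
      rw [Rat.cast_def, ha]; simp [hb]
    have : (N : ℝ) ≠ 0 := by exact_mod_cast hN
    have : (b : ℝ) ≠ 0 := by exact_mod_cast hb0.ne'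
    rw [hdx, h1]
    push_cast
    field_simp
  have hgap (i j : ℕ) (hij : i < j) (hd : ∀ t < n, d (t + i) = d (t + j)) :
      N ≤ C * (j - i) := by
    have h1 := dvd_mul_pow_sub_pow_of_digits_eq (by lia) hx hlt hd
    obtain ⟨s, rfl⟩ := Nat.exists_eq_add_of_lt hij
    have h2 : (N : ℤ) ∣ a * ((q : ℤ) ^ (s + 1) - 1) := by
      have h3 : (N : ℤ) ∣ (q : ℤ) ^ i * (a * ((q : ℤ) ^ (s + 1) - 1)) := by
        refine (Dvd.intro_left (b : ℤ) (by push_cast; rfl)).trans (h1.trans (dvd_of_eq ?_))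
        ring
      refine IsCoprime.dvd_of_dvd_mul_left ?_ h3
      exact (Nat.isCoprime_iff_coprime.2 hNC).pow_right
    have h4 : (N : ℤ) ∣ a * ((Q : ℤ) ^ (s + 1) - 1) := by
      refine h2.trans (mul_dvd_mul_left _ ?_)
      rw [hQdef]
      push_cast
      rw [← pow_mul, mul_comm, pow_mul]
      exact sub_one_dvd_pow_sub_one _ _
    have h5 := dvd_mul_of_dvd_mul_pow_sub_one (fun p hp hpN =>
      (pow_dvd_pow_of_dvd (by exact_mod_cast hNP p hp hpN) 2).trans hPQ) h4
    have h6 : N ∣ C * (s + 1) := by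
      zify [hQ1.le, hC]
      push_cast [mul_assoc] at h5 ⊢
      exact h5
    exact (Nat.le_of_dvd (by positivity) h6).trans (Nat.mul_le_mul_left _ (by lia))
  have hcard : (N - 1) / C + 1 ≤ A.card ^ n := by
    have hinj : Function.Injective fun (i : Fin ((N - 1) / C + 1)) (t : Fin n) =>
        (⟨d (t + i), hdA _⟩ : A) := by
      have aux (i j : Fin ((N - 1) / C + 1)) (h : ∀ t < n, d (t + i) = d (t + j)) :
          ¬ i < j := fun hij => by
        have h1 := hgap i j hij h
        have h2 : C * (j - i : ℕ) ≤ C * ((N - 1) / C) := Nat.mul_le_mul_left _ (by lia)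
        have h3 := Nat.mul_div_le (N - 1) C
        lia
      intro i j hij
      have h (t : ℕ) (ht : t < n) : d (t + i) = d (t + j) := by
        have := congrFun hij ⟨t, ht⟩
        simpa [Fin.ext_iff] using this
      exact le_antisymm (not_lt.1 (aux j i fun t ht => (h t ht).symm)) (not_lt.1 (aux i j h))
    simpa using Fintype.card_le_of_injective _ hinj
  have hNle : N ≤ C * A.card ^ n := by
    have h1 := Nat.lt_mul_div_succ (N - 1) hC0
    have h2 := Nat.mul_le_mul_left C hcard
    lia
  have hnM : n < M := by
    by_contra! h
    refine (hM n h).not_ge (hle.trans ?_)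
    calc q * (b * N) ≤ q * (b * (C * A.card ^ n)) := by gcongr
      _ = _ := by ring
  calc N ≤ b * N := Nat.le_mul_of_pos_left _ hb0
    _ ≤ q ^ n := hlt.le
    _ ≤ q ^ M := Nat.pow_le_pow_right (by lia) hnM.le


theorem stmt_1 (q : ℕ) (hq : 3 ≤ q) (A : Finset ℕ) (hAq : A ⊆ Finset.range q)
    (hA1 : 1 < A.card) (hA2 : A.card < q)
    (ℓ : ℕ) (p : Fin ℓ → ℕ) (hp : ∀ j, 2 ≤ p j)
    (hgcd : Nat.gcd q (∏ j, p j) = 1) (α : ℚ) (hα : 0 < α) :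
    {k : Fin ℓ → ℕ | ((α : ℝ) / ∏ j, (p j : ℝ) ^ (k j)) ∈ K q A}.Finite := by
  have hP : ∏ j, p j ≠ 0 := Finset.prod_ne_zero_iff.2 fun j _ => by have := hp j; lia
  obtain ⟨B, hB⟩ := exists_bound_of_div_mem_K (by lia) hAq hA2 hP hgcd hα
  refine (Set.finite_Iic fun _ : Fin ℓ => B).subset fun k hk j => ?_
  have hpos (i : Fin ℓ) : 0 < p i ^ k i := Nat.pow_pos (by have := hp i; lia)
  have hN : ∏ i, p i ^ k i ≤ B := by
    refine hB _ (Finset.prod_ne_zero_iff.2 fun i _ => (hpos i).ne') (fun r hr hrN => ?_) ?_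
    · obtain ⟨i, hi, hri⟩ := (hr.prime.dvd_finsetProd_iff _).1 hrN
      exact (hr.dvd_of_dvd_pow hri).trans (Finset.dvd_prod_of_mem p hi)
    · simpa using hk
  calc k j ≤ p j ^ k j := (Nat.lt_pow_self (hp j)).le
    _ ≤ ∏ i, p i ^ k i := Nat.le_of_dvd (Finset.prod_pos fun i _ => hpos i)
        (Finset.dvd_prod_of_mem (fun i => p i ^ k i) (Finset.mem_univ j))
    _ ≤ B := hN
end

section
/- Let q ≥ 3 be an integer, b ∈ ℕ, and p_1, p_2, ..., p_ℓ distinct primes such that gcd(q, b p_1 p_2 ⋯ p_ℓ) = 1. Then there exist a positive integer k_0 and finitely many integers a_1, a_2, ..., a_m, each coprime to b (p_1 p_2 ⋯ p_ℓ)^{k_0}, such that for all k_1, k_2, ..., k_ℓ ≥ k_0 and every integer a coprime to N := b p_1^{k_1} p_2^{k_2} ⋯ p_ℓ^{k_ℓ}, there exist exactly one index j ∈ {1,...,m} and some n ∈ ℕ with q^n a_j ≡ a (mod N); equivalently, the cosets of a_1, ..., a_m in the quotient of the unit group (ℤ/Nℤ)^* by the cyclic subgroup generated by q are pairwise distinct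 and exhaust the quotient. -/
/-- Lifting the exponent, in terms of factorizations. -/
lemma Nat.factorization_pow_sub_one {p Q : ℕ} (hp : p.Prime) (hQ : 1 < Q) (hpQ : p ∣ Q - 1)
    (h2 : p = 2 → 4 ∣ Q - 1) {n : ℕ} (hn : n ≠ 0) :
    (Q ^ n - 1).factorization p = (Q - 1).factorization p + n.factorization p := by
  have hQn : 1 < Q ^ n := Nat.one_lt_pow hn hQ
  have hndvd : ¬ p ∣ Q := fun h ↦ hp.one_lt.ne' <| Nat.dvd_one.mp <| by
    simpa [Nat.sub_sub_self hQ.le] using Nat.dvd_sub h hpQ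
  have key : emultiplicity p (Q ^ n - 1) = emultiplicity p (Q - 1) + emultiplicity p n := by
    rcases hp.eq_two_or_odd' with rfl | hodd
    · have h4 : (4 : ℤ) ∣ (Q : ℤ) - 1 := by
        have := Int.natCast_dvd_natCast.mpr (h2 rfl)
        rwa [Nat.cast_sub hQ.le] at this
      have := Int.two_pow_sub_pow' (x := (Q : ℤ)) (y := 1) n h4 (by exact_mod_cast hndvd)
      rw [one_pow] at this
      have e1 : ((Q : ℤ) ^ n - 1) = ((Q ^ n - 1 : ℕ) : ℤ) := by
        rw [Nat.cast_sub hQn.le]; simp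
      have e2 : ((Q : ℤ) - 1) = ((Q - 1 : ℕ) : ℤ) := by
        rw [Nat.cast_sub hQ.le]; simp
      rw [e1, e2] at this
      have e3 : (2 : ℤ) = ((2 : ℕ) : ℤ) := rfl
      rw [e3, Int.natCast_emultiplicity, Int.natCast_emultiplicity,
        Int.natCast_emultiplicity] at this
      exact this
    · simpa using Nat.emultiplicity_pow_sub_pow hp hodd (x := Q) (y := 1) hpQ hndvd n
  have fin : ∀ m : ℕ, m ≠ 0 → emultiplicity p m = (m.factorization p : ℕ∞) := fun m hm ↦ by
    rw [Nat.factorization_def m hp, padicValNat_eq_emultiplicity_of_ne_one hp.ne_one hm]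
  rw [fin _ (by lia), fin _ (by lia), fin _ hn] at key
  exact_mod_cast key

/-- If `R - 1` has the same `p`-adic valuation as `A` for all primes `p ∣ M`, the exponents
`n` with `R ^ n ≡ 1` modulo `A * M` are multiples of `M`. -/
lemma dvd_of_mul_dvd_pow_sub_one {R A M n : ℕ} (hR : 1 < R) (hA : A ≠ 0) (hM : M ≠ 0)
    (hdvd : A ∣ R - 1)
    (hMA : ∀ p : ℕ, p.Prime → p ∣ M → p ∣ A ∧ (p = 2 → 4 ∣ A) ∧
      (R - 1).factorization p = A.factorization p)
    (h : A * M ∣ R ^ n - 1) : M ∣ n := by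
  rcases eq_or_ne n 0 with rfl | hn
  · simp
  have hRn : 1 < R ^ n := Nat.one_lt_pow hn hR
  rw [← Nat.factorization_prime_le_iff_dvd hM hn]
  intro p hp
  by_cases hpM : p ∣ M
  · obtain ⟨h1, h2, h3⟩ := hMA p hp hpM
    have h4 := (Nat.factorization_prime_le_iff_dvd (mul_ne_zero hA hM) (by lia)).mpr h p hp
    rw [Nat.factorization_mul hA hM, Nat.factorization_pow_sub_one hp hR (h1.trans hdvd)
      (fun e ↦ (h2 e).trans hdvd) hn, Finsupp.add_apply, h3] at h4
    lia
  · simp [Nat.factorization_eq_zero_of_not_dvd hpM]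

/-- Under the hypotheses of `dvd_of_mul_dvd_pow_sub_one`, the powers of `R` exhaust the
residue classes modulo `A * M` that reduce to `1` modulo `A`. -/
lemma exists_pow_modEq_of_modEq_one {R A M : ℕ} (hR : 1 < R) (hA : A ≠ 0) (hM : M ≠ 0)
    (hdvd : A ∣ R - 1)
    (hMA : ∀ p : ℕ, p.Prime → p ∣ M → p ∣ A ∧ (p = 2 → 4 ∣ A) ∧
      (R - 1).factorization p = A.factorization p)
    {y : ℕ} (hy : y ≡ 1 [MOD A]) : ∃ t : ℕ, R ^ t ≡ y [MOD A * M] := by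
  have hdvd_pow : ∀ t : ℕ, A ∣ R ^ t - 1 := fun t ↦
    hdvd.trans (by simpa using Nat.sub_dvd_pow_sub_pow R 1 t)
  have hpos : ∀ t : ℕ, 1 ≤ R ^ t := fun t ↦ Nat.one_le_pow _ _ (by lia)
  have modEq_of : ∀ u v : ℕ, 1 ≤ u → 1 ≤ v → A ∣ u - 1 → A ∣ v - 1 →
      (u - 1) / A % M = (v - 1) / A % M → u ≡ v [MOD A * M] := by
    intro u v hu hv hAu hAv h
    have h1 : A * ((u - 1) / A) ≡ A * ((v - 1) / A) [MOD A * M] :=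
      Nat.ModEq.mul_left' A (show _ ≡ _ [MOD M] from h)
    rw [Nat.mul_div_cancel' hAu, Nat.mul_div_cancel' hAv] at h1
    have := h1.add_right 1
    rwa [Nat.sub_add_cancel hu, Nat.sub_add_cancel hv] at this
  have hcopA : Nat.Coprime R A := by
    refine Nat.Coprime.coprime_dvd_right hdvd ?_
    exact (Nat.coprime_self_sub_right hR.le).mpr (Nat.coprime_one_right R)
  have hcop : Nat.Coprime R (A * M) := by
    refine Nat.Coprime.mul_right hcopA (Nat.coprime_of_dvd fun p hp h1 h2 ↦ ?_)
    exact Nat.not_coprime_of_dvd_of_dvd hp.one_lt h1 (hMA p hp h2).1 hcopA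
  have inj_aux : ∀ s t : ℕ, s ≤ t → t < M → R ^ t ≡ R ^ s [MOD A * M] → s = t := by
    intro s t hst ht h
    have h1 : R ^ s * R ^ (t - s) ≡ R ^ s * 1 [MOD A * M] := by
      rwa [← pow_add, Nat.add_sub_cancel' hst, mul_one]
    have h2 : R ^ (t - s) ≡ 1 [MOD A * M] :=
      h1.cancel_left_of_coprime (Nat.Coprime.pow_right s hcop.symm)
    have h3 := dvd_of_mul_dvd_pow_sub_one hR hA hM hdvd hMA
      ((Nat.modEq_iff_dvd' (hpos _)).mp h2.symm)
    have := Nat.eq_zero_of_dvd_of_lt h3 (by lia)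
    lia
  have hinj : Set.InjOn (fun t ↦ (R ^ t - 1) / A % M) (Finset.range M) := by
    intro s hs t ht h
    rw [Finset.coe_range, Set.mem_Iio] at hs ht
    have h1 := modEq_of _ _ (hpos s) (hpos t) (hdvd_pow s) (hdvd_pow t) h
    rcases le_total s t with hst | hst
    · exact inj_aux s t hst ht h1.symm
    · exact (inj_aux t s hst hs h1).symm
  have hsurj := Finset.surjOn_of_injOn_of_card_le (s := Finset.range M) (t := Finset.range M)
    (fun t ↦ (R ^ t - 1) / A % M)
    (fun t _ ↦ by simpa using Nat.mod_lt _ (Nat.pos_of_ne_zero hM)) hinj le_rfl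
  have hy1 : 1 ≤ y + A * M := by
    have := Nat.pos_of_ne_zero (mul_ne_zero hA hM)
    lia
  have hyA : A ∣ y + A * M - 1 :=
    (Nat.modEq_iff_dvd' hy1).mp (by simpa [Nat.ModEq] using hy.symm)
  obtain ⟨t, -, ht⟩ := hsurj (show (y + A * M - 1) / A % M ∈ (Finset.range M : Set ℕ) by
    simpa using Nat.mod_lt _ (Nat.pos_of_ne_zero hM))
  refine ⟨t, (modEq_of _ _ (hpos t) hy1 (hdvd_pow t) hyA ht).trans ?_⟩
  simp [Nat.ModEq]

/-- Orbit representatives of the multiplication by `q` on the units modulo `N`. -/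
lemma exists_orbit_representatives {q N : ℕ} (hN : N ≠ 0) (hq : Nat.Coprime q N) :
    ∃ (m : ℕ) (a : Fin m → ℕ), (∀ i, Nat.Coprime (a i) N) ∧
      ∀ x : ℕ, Nat.Coprime x N → ∃! i : Fin m, ∃ n : ℕ, q ^ n * a i ≡ x [MOD N] := by
  have : NeZero N := ⟨hN⟩
  let H : Subgroup (ZMod N)ˣ := Subgroup.zpowers (ZMod.unitOfCoprime q hq)
  let e := Finite.equivFin ((ZMod N)ˣ ⧸ H)
  refine ⟨_, fun i ↦ ((e.symm i).out : ZMod N).val, fun i ↦ ZMod.val_coe_unit_coprime _,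
    fun x hx ↦ ?_⟩
  have key : ∀ i, (∃ n : ℕ, q ^ n * ((e.symm i).out : ZMod N).val ≡ x [MOD N]) ↔
      i = e (ZMod.unitOfCoprime x hx) := by
    intro i
    rw [← Equiv.symm_apply_eq, ← QuotientGroup.out_eq' (e.symm i), QuotientGroup.eq,
      ← mem_powers_iff_mem_zpowers, Submonoid.mem_powers_iff, QuotientGroup.out_eq']
    refine exists_congr fun n ↦ ?_
    rw [eq_inv_mul_iff_mul_eq, Units.ext_iff, ← ZMod.natCast_eq_natCast_iff]
    simp [mul_comm]
  exact ⟨_, (key _).mpr rfl, fun i hi ↦ (key i).mp hi⟩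

/-- The exponent of `p i` in a product of powers of distinct primes. -/
lemma factorization_prod_prime_pow {ℓ : ℕ} {p : Fin ℓ → ℕ} (hp : ∀ j, (p j).Prime)
    (hinj : Function.Injective p) (f : Fin ℓ → ℕ) (i : Fin ℓ) :
    (∏ j, p j ^ f j).factorization (p i) = f i := by
  rw [Nat.factorization_prod_apply fun j _ ↦ pow_ne_zero _ (hp j).ne_zero,
    Finset.sum_eq_single i]
  · simp [(hp i).factorization_self]
  · intro j _ hj
    simp [(hp j).factorization, hinj.ne hj]
  · simp

/-- For large `k0`, some power `R` of `q` generates the congruence subgroup at level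
`b * (∏ p j) ^ k0`. -/
lemma exists_pow_with_exact_valuation {q b ℓ : ℕ} (hq : 3 ≤ q) (hb : 0 < b)
    {p : Fin ℓ → ℕ} (hp : ∀ j, (p j).Prime) (hinj : Function.Injective p)
    (hgcd : Nat.Coprime q (b * ∏ j, p j)) :
    ∃ k0 d : ℕ, 2 ≤ k0 ∧ 1 < q ^ d ∧ b * (∏ j, p j) ^ k0 ∣ q ^ d - 1 ∧
      ∀ j, (q ^ d - 1).factorization (p j) = (b * (∏ j, p j) ^ k0).factorization (p j) := by
  set P := ∏ j, p j with hP
  have hP0 : P ≠ 0 := Finset.prod_ne_zero_iff.mpr fun j _ ↦ (hp j).ne_zero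
  have hpP : ∀ j, p j ∣ P := fun j ↦ Finset.dvd_prod_of_mem p (Finset.mem_univ j)
  have hbP : 0 < (b * P) ^ 2 := by positivity
  set Q := q ^ ((b * P) ^ 2).totient with hQ
  have hQ1 : 1 < Q := Nat.one_lt_pow (Nat.totient_pos.mpr hbP).ne' (by lia)
  have hdvdQ : (b * P) ^ 2 ∣ Q - 1 :=
    (Nat.modEq_iff_dvd' hQ1.le).mp (Nat.ModEq.pow_totient (hgcd.pow_right 2)).symm
  have hbQ : b ∣ Q - 1 := (Dvd.intro P rfl).trans ((dvd_pow_self _ two_ne_zero).trans hdvdQ)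
  have hpQ : ∀ j, p j ∣ Q - 1 := fun j ↦
    ((hpP j).mul_left b).trans ((dvd_pow_self _ two_ne_zero).trans hdvdQ)
  have h4Q : ∀ j, p j = 2 → 4 ∣ Q - 1 := fun j hj ↦ by
    have := pow_dvd_pow_of_dvd ((hpP j).mul_left b) 2
    rw [hj] at this
    exact this.trans hdvdQ
  set k0 := Q + 2
  let f : Fin ℓ → ℕ := fun j ↦ k0 + b.factorization (p j) - (Q - 1).factorization (p j)
  set e := ∏ j, p j ^ f j
  have he0 : e ≠ 0 := Finset.prod_ne_zero_iff.mpr fun j _ ↦ pow_ne_zero _ (hp j).ne_zero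
  have hval : ∀ j, (Q ^ e - 1).factorization (p j) = (b * P ^ k0).factorization (p j) := by
    intro j
    rw [Nat.factorization_pow_sub_one (hp j) hQ1 (hpQ j) (h4Q j) he0,
      factorization_prod_prime_pow hp hinj, Nat.factorization_mul hb.ne' (pow_ne_zero _ hP0),
      Finsupp.add_apply, hP, ← Finset.prod_pow,
      factorization_prod_prime_pow hp hinj (fun _ ↦ k0)]
    have : (Q - 1).factorization (p j) < Q - 1 := Nat.factorization_lt _ (by lia)
    simp only [f, k0]
    lia
  have hQe : 1 < Q ^ e := Nat.one_lt_pow he0 hQ1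
  refine ⟨k0, ((b * P) ^ 2).totient * e, by lia, ?_, ?_, ?_⟩ <;> rw [pow_mul, ← hQ]
  · exact hQe
  · rw [← Nat.factorization_prime_le_iff_dvd (by positivity) (by lia)]
    intro r hr
    by_cases hrP : r ∣ P
    · obtain ⟨j, -, hj⟩ := (hr.prime.dvd_finsetProd_iff p).mp hrP
      rw [(Nat.prime_dvd_prime_iff_eq hr (hp j)).mp hj]
      exact (hval j).ge
    · rw [Nat.factorization_mul hb.ne' (pow_ne_zero _ hP0), Nat.factorization_pow]
      simp only [Finsupp.add_apply, Finsupp.smul_apply,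
        Nat.factorization_eq_zero_of_not_dvd hrP, smul_zero, add_zero]
      exact (Nat.factorization_prime_le_iff_dvd hb.ne' (by lia)).mpr
        (hbQ.trans (by simpa using Nat.sub_dvd_pow_sub_pow Q 1 e)) r hr
  · exact hval

theorem stmt_8 (q b ℓ : ℕ) (hq : 3 ≤ q) (hb : 0 < b)
    (p : Fin ℓ → ℕ) (hp : ∀ j, (p j).Prime) (hinj : Function.Injective p)
    (hgcd : Nat.gcd q (b * ∏ j, p j) = 1) :
    ∃ (k0 m : ℕ) (a : Fin m → ℕ),
      0 < k0 ∧
      (∀ i, Nat.Coprime (a i) (b * (∏ j, p j) ^ k0)) ∧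
      ∀ k : Fin ℓ → ℕ, (∀ j, k0 ≤ k j) →
        ∀ x : ℕ, Nat.Coprime x (b * ∏ j, p j ^ (k j)) →
          ∃! i : Fin m, ∃ n : ℕ,
            q ^ n * a i ≡ x [MOD b * ∏ j, p j ^ (k j)] := by
  obtain ⟨k0, d, hk0, hR, hdvd, hval⟩ := exists_pow_with_exact_valuation hq hb hp hinj hgcd
  have hP0 : ∏ j, p j ≠ 0 := Finset.prod_ne_zero_iff.mpr fun j _ ↦ (hp j).ne_zero
  have hpP : ∀ j, p j ∣ ∏ j, p j := fun j ↦ Finset.dvd_prod_of_mem p (Finset.mem_univ j)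
  set A := b * (∏ j, p j) ^ k0 with hA
  have hA0 : A ≠ 0 := mul_ne_zero hb.ne' (pow_ne_zero _ hP0)
  have hqA : Nat.Coprime q A :=
    (Nat.Coprime.coprime_mul_right_right hgcd).mul_right
      ((Nat.Coprime.coprime_mul_left_right hgcd).pow_right k0)
  obtain ⟨m, a, ha, hrep⟩ := exists_orbit_representatives hA0 hqA
  refine ⟨k0, m, a, by lia, ha, fun k hk x hx ↦ ?_⟩
  set M := ∏ j, p j ^ (k j - k0) with hM
  have hM0 : M ≠ 0 := Finset.prod_ne_zero_iff.mpr fun j _ ↦ pow_ne_zero _ (hp j).ne_zero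
  have hN : b * ∏ j, p j ^ k j = A * M := by
    rw [hA, hM, ← Finset.prod_pow, mul_assoc, ← Finset.prod_mul_distrib]
    simp only [← pow_add]
    congr! 3 with j
    have := hk j
    lia
  rw [hN] at hx ⊢
  have hMA : ∀ r : ℕ, r.Prime → r ∣ M → r ∣ A ∧ (r = 2 → 4 ∣ A) ∧
      (q ^ d - 1).factorization r = A.factorization r := by
    intro r hr hrM
    obtain ⟨j, -, hj⟩ := (hr.prime.dvd_finsetProd_iff _).mp hrM
    obtain rfl := (Nat.prime_dvd_prime_iff_eq hr (hp j)).mp (hr.dvd_of_dvd_pow hj)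
    have hsq : p j ^ 2 ∣ A :=
      ((pow_dvd_pow_of_dvd (hpP j) 2).trans (pow_dvd_pow _ hk0)).mul_left b
    exact ⟨(dvd_pow_self _ two_ne_zero).trans hsq, fun h ↦ by simpa [h] using hsq, hval j⟩
  have coprime_lift : ∀ z : ℕ, Nat.Coprime z A → Nat.Coprime z (A * M) := fun z hz ↦
    hz.mul_right <| Nat.coprime_of_dvd fun r hr h1 h2 ↦
      Nat.not_coprime_of_dvd_of_dvd hr.one_lt h1 (hMA r hr h2).1 hz
  obtain ⟨i, ⟨n, hn⟩, huniq⟩ := hrep x hx.coprime_mul_right_right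
  refine ⟨i, ?_, fun i' ⟨n', hn'⟩ ↦ huniq i' ⟨n', hn'.of_mul_right M⟩⟩
  have hzA : Nat.Coprime (q ^ n * a i) A := (hqA.pow_left n).mul_left (ha i)
  obtain ⟨y, -, hyx : q ^ n * a i * y ≡ x [MOD A * M]⟩ :=
    Nat.exists_mul_mod_eq_of_coprime x (coprime_lift _ hzA) (mul_ne_zero hA0 hM0)
  have hy : y ≡ 1 [MOD A] := by
    refine Nat.ModEq.cancel_left_of_coprime hzA.symm ?_
    rw [mul_one]
    exact (hyx.of_mul_right M).trans hn.symm
  obtain ⟨t, ht⟩ := exists_pow_modEq_of_modEq_one hR hA0 hM0 hdvd hMA hy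
  refine ⟨n + d * t, ?_⟩
  rw [pow_add, pow_mul, mul_right_comm (q ^ n)]
  exact (ht.mul_left _).trans hyx
end

section
/- Let q ≥ 3 be an integer and A a subset of {0,1,...,q-1} with 1 < #A < q, and let K(q,A) = { Σ_{i=1}^∞ d_i/q^i : d_i ∈ A for all i ∈ ℕ }. Let p ≥ 2 be an integer with gcd(p,q) = 1. If x and y are integers with 1 ≤ x, y ≤ p, gcd(x,p) = gcd(y,p) = 1, and there exists n ∈ ℕ with q^n x ≡ y (mod p), then x/p ∈ K(q,A) if and only if y/p ∈ K(q,A). -/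
theorem digitSum_summable {q : ℕ} (hq : 3 ≤ q) {d : ℕ → ℕ} (hd : ∀ i, d i < q) :
    Summable fun i : ℕ => (d i : ℝ) / (q : ℝ) ^ (i + 1) := by
  have hq0 : (0 : ℝ) < q := by positivity
  have hq1 : (q : ℝ)⁻¹ < 1 := inv_lt_one_of_one_lt₀ (by exact_mod_cast (by omega : 1 < q))
  refine Summable.of_nonneg_of_le (fun i => by positivity) (fun i => ?_)
    (summable_geometric_of_lt_one (by positivity) hq1)
  have h : (d i : ℝ) ≤ q := by exact_mod_cast (hd i).le
  rw [inv_pow, div_le_iff₀ (by positivity), pow_succ, inv_mul_cancel_left₀ (by positivity)]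
  exact h

theorem digitSum_le_one {q : ℕ} (hq : 3 ≤ q) {d : ℕ → ℕ} (hd : ∀ i, d i < q) :
    ∑' i : ℕ, (d i : ℝ) / (q : ℝ) ^ (i + 1) ≤ 1 := by
  have hq0 : (0 : ℝ) < q := by positivity
  have hq2 : (1 : ℝ) < q := by exact_mod_cast (by omega : 1 < q)
  have hq1 : (q : ℝ)⁻¹ < 1 := inv_lt_one_of_one_lt₀ hq2
  have hgeom := (hasSum_geometric_of_lt_one (by positivity) hq1).mul_left (((q : ℝ) - 1) / q)
  have hone : ((q : ℝ) - 1) / q * (1 - (q : ℝ)⁻¹)⁻¹ = 1 := by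
    have : (q : ℝ) - 1 ≠ 0 := by linarith
    field_simp
  rw [hone] at hgeom
  refine hasSum_le (fun i => ?_) (digitSum_summable hq hd).hasSum hgeom
  have h : (d i : ℝ) + 1 ≤ q := by exact_mod_cast hd i
  have he : ((q : ℝ) - 1) / q * (q : ℝ)⁻¹ ^ i = ((q : ℝ) - 1) / (q : ℝ) ^ (i + 1) := by
    rw [inv_pow, pow_succ]
    field_simp
  rw [he]
  gcongr
  linarith

theorem mul_mod_div_mem_K {q p : ℕ} (hq : 3 ≤ q) {A : Finset ℕ} (hAq : A ⊆ Finset.range q)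
    (hp : 2 ≤ p) {x : ℕ} (hcop : Nat.Coprime (q * x) p) (hx : (x : ℝ) / p ∈ K q A) :
    ((q * x % p : ℕ) : ℝ) / p ∈ K q A := by
  obtain ⟨d, hdA, hd⟩ := hx
  have hlt : ∀ i, d i < q := fun i => Finset.mem_range.mp (hAq (hdA i))
  refine ⟨fun i => d (i + 1), fun i => hdA _, ?_⟩
  have hq0 : (0 : ℝ) < q := by positivity
  have hp0 : (0 : ℝ) < p := by positivity
  set t := ∑' i : ℕ, ((d (i + 1) : ℕ) : ℝ) / (q : ℝ) ^ (i + 1) with ht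
  have ht0 : 0 ≤ t := tsum_nonneg fun i => by positivity
  have ht1 : t ≤ 1 := digitSum_le_one hq fun i => hlt (i + 1)
  have hsplit : (x : ℝ) / p * q = d 0 + t := by
    have hshift (i : ℕ) : (d (i + 1) : ℝ) / (q : ℝ) ^ (i + 1 + 1)
        = (d (i + 1) : ℝ) / (q : ℝ) ^ (i + 1) / q := by
      rw [pow_succ, div_div]
    rw [hd, (digitSum_summable hq hlt).tsum_eq_zero_add]
    simp only [hshift]
    rw [tsum_div_const, ← ht, zero_add, pow_one]
    field_simp
  set z := q * x % p with hz
  have hz_lt : z < p := Nat.mod_lt _ (by omega)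
  have hz_pos : 0 < z := by
    refine Nat.pos_of_ne_zero fun h => ?_
    have := Nat.eq_one_of_dvd_coprimes hcop (Nat.dvd_of_mod_eq_zero h) dvd_rfl
    omega
  have hz0 : 0 < (z : ℝ) / p := by positivity
  have hz1 : (z : ℝ) / p < 1 := by
    rw [div_lt_one hp0]
    exact_mod_cast hz_lt
  have hdiv : (x : ℝ) / p * q = (q * x / p : ℕ) + (z : ℝ) / p := by
    have h : (p : ℝ) * (q * x / p : ℕ) + z = q * x := by
      exact_mod_cast Nat.div_add_mod (q * x) p
    field_simp
    linarith
  have hnat : d 0 = q * x / p := by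
    have h1 : (d 0 : ℝ) < (q * x / p : ℕ) + 1 := by linarith
    have h2 : ((q * x / p : ℕ) : ℝ) < d 0 + 1 := by linarith
    exact le_antisymm (Nat.lt_succ_iff.mp (by exact_mod_cast h1))
      (Nat.lt_succ_iff.mp (by exact_mod_cast h2))
  rw [← hnat] at hdiv
  linarith

theorem div_mem_K_of_pow_mul_modEq {q p : ℕ} (hq : 3 ≤ q) {A : Finset ℕ}
    (hAq : A ⊆ Finset.range q) (hp : 2 ≤ p) (hpq : Nat.Coprime p q) (n : ℕ) {x y : ℕ}
    (hx : x < p) (hy : y < p) (hxcop : Nat.Coprime x p) (h : q ^ n * x ≡ y [MOD p])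
    (hxK : (x : ℝ) / p ∈ K q A) : (y : ℝ) / p ∈ K q A := by
  induction n generalizing x with
  | zero =>
    rw [pow_zero, one_mul] at h
    rwa [← h.eq_of_lt_of_lt hx hy]
  | succ n ih =>
    have hcop : Nat.Coprime (q * x) p := hpq.symm.mul_left hxcop
    refine ih (x := q * x % p) (Nat.mod_lt _ (by omega)) ?_ ?_
      (mul_mod_div_mem_K hq hAq hp hcop hxK)
    · rwa [Nat.Coprime, (Nat.mod_modEq (q * x) p).gcd_eq]
    · refine ((Nat.mod_modEq (q * x) p).mul_left (q ^ n)).trans ?_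
      rwa [← mul_assoc, ← pow_succ]

theorem stmt_9 (q p : ℕ) (hq : 3 ≤ q) (A : Finset ℕ) (hAq : A ⊆ Finset.range q)
    (hA1 : 1 < A.card) (hA2 : A.card < q) (hp : 2 ≤ p) (hpq : Nat.gcd p q = 1)
    (x y : ℕ) (hx1 : 1 ≤ x) (hxp : x ≤ p) (hy1 : 1 ≤ y) (hyp : y ≤ p)
    (hxcop : Nat.gcd x p = 1) (hycop : Nat.gcd y p = 1)
    (hsim : ∃ n : ℕ, q ^ n * x ≡ y [MOD p]) :
    (x : ℝ) / p ∈ K q A ↔ (y : ℝ) / p ∈ K q A := by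
  have lt_of_coprime {z : ℕ} (hz : z ≤ p) (hcop : Nat.gcd z p = 1) : z < p := by
    refine lt_of_le_of_ne hz fun h => ?_
    rw [h, Nat.gcd_self] at hcop
    omega
  have hx := lt_of_coprime hxp hxcop
  have hy := lt_of_coprime hyp hycop
  obtain ⟨n, hn⟩ := hsim
  refine ⟨div_mem_K_of_pow_mul_modEq hq hAq hp hpq n hx hy hxcop hn,
    div_mem_K_of_pow_mul_modEq hq hAq hp hpq (n * (p.totient - 1)) hy hx hycop ?_⟩
  have hphi : 0 < p.totient := Nat.totient_pos.mpr (by omega)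
  have hexp : n * (p.totient - 1) + n = p.totient * n := by
    obtain ⟨k, hk⟩ := Nat.exists_eq_add_of_lt hphi
    rw [hk, zero_add, Nat.add_sub_cancel]
    ring
  have hpow : q ^ (p.totient * n) ≡ 1 [MOD p] := by
    have h := (Nat.ModEq.pow_totient (Nat.Coprime.symm hpq)).pow n
    rwa [one_pow, ← pow_mul] at h
  refine (hn.symm.mul_left (q ^ (n * (p.totient - 1)))).trans ?_
  rw [← mul_assoc, ← pow_add, hexp]
  simpa using hpow.mul_right x
end

section
/- Let q ≥ 3 be an integer and A a subset of {0,1,...,q-1} with 1 < #A < q, and let K(q,A) = { Σ_{i=1}^∞ d_i/q^i : d_i ∈ A for all i ∈ ℕ }. Let p_1, p_2, ..., p_ℓ ≥ 2 be integers such that each p_j has a prime factor that does not divide q. Then for any positive rational number α, the set { (k_1, k_2, ..., k_ℓ) ∈ ℕ_0^ℓ : α/(p_1^{k_1} p_2^{k_2} ⋯ p_ℓ^{k_ℓ}) ∈ K(q,A) } is finite. -/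
open Finset in
theorem dvd_geom_sum_sub_natCast {z d : ℤ} (h : d ∣ z - 1) (n : ℕ) :
    d ∣ ∑ i ∈ range n, z ^ i - n := by
  have : ∑ i ∈ range n, z ^ i - (n : ℤ) = ∑ i ∈ range n, (z ^ i - 1) := by
    simp [Finset.sum_sub_distrib]
  rw [this]
  exact dvd_sum fun i _ => h.trans (sub_one_dvd_pow_sub_one z i)

theorem natCast_dvd_pow_sub_one (y : ℤ) (E : ℕ) (hE : E ≠ 0)
    (h : ∀ p : ℕ, p.Prime → p ∣ E → (p : ℤ) ∣ y - 1) : (E : ℤ) ∣ y ^ E - 1 := by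
  induction E using induction_on_primes with
  | zero => exact absurd rfl hE
  | one => simp
  | prime_mul p a hp ih =>
    have ha : a ≠ 0 := by rintro rfl; simp at hE
    have h1 := ih ha fun l hl hla => h l hl (hla.mul_left p)
    have hpy : (p : ℤ) ∣ y ^ a - 1 :=
      (h p hp (dvd_mul_right p a)).trans (sub_one_dvd_pow_sub_one y a)
    have h2 := dvd_geom_sum_sub_natCast hpy p
    rw [dvd_sub_self_right] at h2
    rw [mul_comm p a, pow_mul, ← geom_sum_mul (y ^ a) p, mul_comm a p]
    push_cast
    exact mul_dvd_mul h2 h1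

theorem pow_prime_pow_eq {c w : ℕ} (hc : c.Prime) (hw : 2 ≤ w) {z E h : ℤ}
    (hz : z = 1 + E * c ^ w * h) (hh : ¬ (c : ℤ) ∣ h) (s : ℕ) :
    ∃ h' : ℤ, z ^ c ^ s = 1 + E * c ^ (w + s) * h' ∧ ¬ (c : ℤ) ∣ h' := by
  induction s with
  | zero => exact ⟨h, by simpa using hz, hh⟩
  | succ s ih =>
    obtain ⟨h', e, hh'⟩ := ih
    have hd : (c : ℤ) ^ 2 ∣ z ^ c ^ s - 1 := by
      rw [e, add_sub_cancel_left]
      exact ((pow_dvd_pow _ (by omega)).mul_left _).mul_right _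
    obtain ⟨m, hm⟩ := dvd_geom_sum_sub_natCast hd c
    refine ⟨h' * (1 + c * m), ?_, ?_⟩
    · have := geom_sum_mul (z ^ c ^ s) c
      rw [pow_succ c s, pow_mul]
      rw [sub_eq_iff_eq_add.1 hm, e] at this
      rw [e]
      linear_combination -this
    · rw [(Nat.prime_iff_prime_int.1 hc).dvd_mul]
      rintro (H | H)
      · exact hh' H
      · rw [Int.dvd_add_left (dvd_mul_right _ _)] at H
        exact (Nat.prime_iff_prime_int.1 hc).not_dvd_one H

theorem one_add_pow_eq (x : ℤ) (t : ℕ) : ∃ k : ℤ, (1 + x) ^ t = 1 + t * x + k * x ^ 2 := by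
  induction t with
  | zero => exact ⟨0, by simp⟩
  | succ t ih =>
    obtain ⟨k, hk⟩ := ih
    exact ⟨t + k + k * x, by rw [pow_succ, hk]; push_cast; ring⟩

theorem exists_nat_mul_eq_add {c : ℕ} (hc : c.Prime) {v : ℤ} (hv : ¬ (c : ℤ) ∣ v) (r : ℕ) (i : ℤ) :
    ∃ (t : ℕ) (m : ℤ), t * v = i + c ^ r * m := by
  have hcop : IsCoprime v ((c : ℤ) ^ r) :=
    (((Nat.prime_iff_prime_int.1 hc).coprime_iff_not_dvd.2 hv).symm).pow_right
  obtain ⟨a, b, hab⟩ := hcop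
  have hpos : (0 : ℤ) < (c : ℤ) ^ r := pow_pos (by exact_mod_cast hc.pos) r
  have h1 := Int.emod_nonneg (a * i) hpos.ne'
  have h2 := Int.emod_add_mul_ediv (a * i) ((c : ℤ) ^ r)
  refine ⟨((a * i) % (c : ℤ) ^ r).toNat, -(b * i) - (a * i) / (c : ℤ) ^ r * v, ?_⟩
  rw [Int.toNat_of_nonneg h1]
  linear_combination v * h2 + i * hab

/-- Multiplication by powers of `q` moves `u / (E c^(w+s+r))` through all of its translates
by multiples of `1 / c^r`, modulo one. -/
theorem exists_pow_mul_eq {q c T w E : ℕ} {g : ℤ} (hc : c.Prime) (hw : 2 ≤ w)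
    (hg : (q : ℤ) ^ T - 1 = c ^ w * g) (hcg : ¬ (c : ℤ) ∣ g) (hcE : ¬ c ∣ E)
    (hE : ∀ p : ℕ, p.Prime → p ∣ E → (p : ℤ) ∣ (q : ℤ) ^ T - 1) {s r : ℕ} (hr : r ≤ w + s)
    {u : ℤ} (hu : ¬ (c : ℤ) ∣ u) (i : ℤ) :
    ∃ (j : ℕ) (k : ℤ), (q : ℤ) ^ j * u = u + i * (E * c ^ (w + s)) + k * (E * c ^ (w + s + r)) := by
  have hcp := Nat.prime_iff_prime_int.1 hc
  have hE0 : E ≠ 0 := by rintro rfl; simp at hcE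
  have hcE' : ¬ (c : ℤ) ∣ (E : ℤ) := by exact_mod_cast hcE
  obtain ⟨h, hh⟩ : ∃ h : ℤ, ((q : ℤ) ^ T) ^ E = 1 + E * c ^ w * h ∧ ¬ (c : ℤ) ∣ h := by
    have hcY : (c : ℤ) ∣ (q : ℤ) ^ T - 1 := by
      rw [hg]; exact (dvd_pow_self _ (by omega)).mul_right _
    have h1 := geom_sum_mul ((q : ℤ) ^ T) E
    set S := ∑ x ∈ Finset.range E, ((q : ℤ) ^ T) ^ x with hS
    have hSc : ¬ (c : ℤ) ∣ S := fun H =>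
      hcE' ((dvd_sub_right H).1 (dvd_geom_sum_sub_natCast hcY E))
    have h2 := natCast_dvd_pow_sub_one _ E hE0 hE
    have h3 : (E : ℤ) ∣ c ^ w * (S * g) := by
      rw [← h1, hg] at h2
      convert h2 using 1; ring
    have hcop : IsCoprime (E : ℤ) ((c : ℤ) ^ w) :=
      ((hcp.coprime_iff_not_dvd.2 hcE').symm).pow_right
    obtain ⟨h, hh⟩ := hcop.dvd_of_dvd_mul_left h3
    refine ⟨h, ?_, fun H => ?_⟩
    · rw [hg] at h1
      linear_combination -h1 + (c : ℤ) ^ w * hh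
    · have := H.mul_left (E : ℤ)
      rw [← hh, hcp.dvd_mul] at this
      exact this.elim hSc hcg
  obtain ⟨hh, hnh⟩ := hh
  obtain ⟨h', e, hh'⟩ := pow_prime_pow_eq hc hw hh hnh s
  obtain ⟨t, m, ht⟩ := exists_nat_mul_eq_add hc (v := h' * u)
    (by rw [hcp.dvd_mul]; tauto) r i
  obtain ⟨k, hk⟩ := one_add_pow_eq (E * c ^ (w + s) * h') t
  obtain ⟨d, hd⟩ := Nat.exists_eq_add_of_le hr
  refine ⟨T * E * c ^ s * t, m + k * E * h' ^ 2 * u * c ^ d, ?_⟩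
  have hpow : (c : ℤ) ^ (w + s + r) = c ^ (w + s) * c ^ r := pow_add _ _ _
  have hpow' : (c : ℤ) ^ (w + s) = c ^ r * c ^ d := by rw [hd, pow_add]
  rw [pow_mul, pow_mul, pow_mul, e, hk, hpow]
  linear_combination (E * (c : ℤ) ^ (w + s)) * ht +
    (k * E ^ 2 * c ^ (w + s) * h' ^ 2 * u) * hpow'

theorem exists_pow_mul_mem_Ioo {q c T w E : ℕ} {g : ℤ} (hq : 0 < q) (hc : c.Prime) (hw : 2 ≤ w)
    (hg : (q : ℤ) ^ T - 1 = c ^ w * g) (hcg : ¬ (c : ℤ) ∣ g) (hcE : ¬ c ∣ E)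
    (hE : ∀ p : ℕ, p.Prime → p ∣ E → (p : ℤ) ∣ (q : ℤ) ^ T - 1) {n : ℕ} (hn : w + 2 * q ≤ n)
    {u : ℤ} (hu : ¬ (c : ℤ) ∣ u) (b : ℝ) :
    ∃ (j : ℕ) (k : ℤ),
      (q : ℝ) ^ j * (u / (E * c ^ n)) - k ∈ Set.Ioo (b / q) ((b + 1) / q) := by
  obtain ⟨s, rfl⟩ : ∃ s, n = w + s + q := ⟨n - w - q, by omega⟩
  have hE0 : (E : ℝ) ≠ 0 := by
    have : E ≠ 0 := by rintro rfl; simp at hcE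
    exact_mod_cast this
  have hc0 : (0 : ℝ) < c := by exact_mod_cast hc.pos
  have hq0 : (0 : ℝ) < q := by exact_mod_cast hq
  have hqc : (q : ℝ) < (c : ℝ) ^ q := by exact_mod_cast Nat.lt_pow_self hc.one_lt
  set y : ℝ := u / (E * c ^ (w + s + q)) with hy
  set i : ℤ := ⌊(c : ℝ) ^ q * (b / q - y)⌋ + 1 with hi
  have hi1 : (c : ℝ) ^ q * (b / q - y) < i := by
    rw [hi]; push_cast; exact Int.lt_floor_add_one _
  have hi2 : (i : ℝ) ≤ (c : ℝ) ^ q * (b / q - y) + 1 := by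
    rw [hi]; push_cast; gcongr; exact Int.floor_le _
  obtain ⟨j, k, hjk⟩ := exists_pow_mul_eq hc hw hg hcg hcE hE (s := s) (r := q) (by omega) hu i
  have hjk' : (q : ℝ) ^ j * u = u + i * (E * c ^ (w + s)) + k * (E * c ^ (w + s + q)) := by
    exact_mod_cast hjk
  have key : (q : ℝ) ^ j * y - k = y + i / c ^ q := by
    rw [hy, ← mul_div_assoc, hjk', pow_add _ (w + s) q]
    field_simp
    ring
  have hcq : (0 : ℝ) < (c : ℝ) ^ q := by positivity
  refine ⟨j, k, ?_⟩
  rw [key]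
  constructor
  · have : b / q - y < i / c ^ q := by rw [lt_div_iff₀ hcq]; linarith
    linarith
  · have h1 : (i : ℝ) / c ^ q ≤ b / q - y + 1 / c ^ q := by
      rw [div_le_iff₀ hcq, add_mul, div_mul_cancel₀ _ hcq.ne']; linarith
    have h2 : 1 / (c : ℝ) ^ q < 1 / q := one_div_lt_one_div_of_lt hq0 hqc
    rw [add_div]
    linarith

theorem Nat.exists_mul_eq_dvd_pow_coprime (q W : ℕ) (hW : W ≠ 0) :
    ∃ Q R m : ℕ, W = Q * R ∧ Q ∣ q ^ m ∧ R.Coprime q := by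
  induction W using induction_on_primes with
  | zero => exact absurd rfl hW
  | one => exact ⟨1, 1, 0, by simp⟩
  | prime_mul p a hp ih =>
    obtain ⟨Q, R, m, rfl, hQ, hR⟩ := ih (by rintro rfl; simp at hW)
    by_cases h : p ∣ q
    · exact ⟨p * Q, R, m + 1, by ring, by rw [pow_succ']; exact mul_dvd_mul h hQ, hR⟩
    · exact ⟨Q, p * R, m, by ring, hQ, Nat.Coprime.mul_left ((hp.coprime_iff_not_dvd).2 h) hR⟩

theorem exists_prime_sq_dvd_pow_sub_one (q B : ℕ) (hB : B ≠ 0) :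
    ∃ T : ℕ, T ≠ 0 ∧ ∀ p : ℕ, p.Prime → p ∣ B → ¬ p ∣ q → (p : ℤ) ^ 2 ∣ (q : ℤ) ^ T - 1 := by
  obtain ⟨Q, R, m, hBR, hQ, hR⟩ := Nat.exists_mul_eq_dvd_pow_coprime q B hB
  have hR0 : R ≠ 0 := by rintro rfl; simp at hBR; exact hB hBR
  refine ⟨(R ^ 2).totient, (Nat.totient_pos.2 (by positivity)).ne', fun p hp hpB hpq => ?_⟩
  have hpR : p ∣ R := by
    rw [hBR, hp.dvd_mul] at hpB
    exact hpB.resolve_left fun h => hpq (hp.dvd_of_dvd_pow (h.trans hQ))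
  have h1 := (Nat.modEq_iff_dvd.1 (Nat.ModEq.pow_totient (hR.symm.pow_right 2)).symm)
  push_cast at h1
  exact (pow_dvd_pow_of_dvd (by exact_mod_cast hpR) 2).trans h1

theorem exists_digit_mem_K {q : ℕ} {A : Finset ℕ} (hAq : A ⊆ Finset.range q) {x : ℝ}
    (hx : x ∈ K q A) :
    0 ≤ x ∧ x ≤ 1 ∧ ∃ d ∈ A, ∃ y ∈ K q A, q * x = d + y := by
  obtain ⟨d, hd, rfl⟩ := hx
  have hdq : ∀ i, d i < q := fun i => Finset.mem_range.1 (hAq (hd i))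
  have hq0 : (q : ℝ) ≠ 0 := by
    have := hdq 0
    exact_mod_cast (by omega : q ≠ 0)
  let D : ℕ → Fin q := fun i => ⟨d i, hdq i⟩
  have hD : ∑' i : ℕ, (d i : ℝ) / (q : ℝ) ^ (i + 1) = Real.ofDigits D := by
    simp [Real.ofDigits, Real.ofDigitsTerm, D, div_eq_mul_inv]
  have h1 := Real.ofDigits_eq_sum_add_ofDigits D 1
  rw [hD]
  refine ⟨Real.ofDigits_nonneg D, Real.ofDigits_le_one D, d 0, hd 0,
    Real.ofDigits fun i => D (i + 1), ⟨fun i => d (i + 1), fun i => hd _, ?_⟩, ?_⟩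
  · simp [Real.ofDigits, Real.ofDigitsTerm, D, div_eq_mul_inv]
  · rw [h1]
    simp only [Finset.range_one, Finset.sum_singleton, Real.ofDigitsTerm, D]
    field_simp
    ring

theorem exists_int_pow_mul_sub_mem_K {q : ℕ} {A : Finset ℕ} (hAq : A ⊆ Finset.range q) {x : ℝ}
    (hx : x ∈ K q A) (j : ℕ) : ∃ k : ℤ, (q : ℝ) ^ j * x - k ∈ K q A := by
  induction j with
  | zero => exact ⟨0, by simpa using hx⟩
  | succ j ih =>
    obtain ⟨k, hk⟩ := ih
    obtain ⟨-, -, d, -, y, hy, e⟩ := exists_digit_mem_K hAq hk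
    refine ⟨q * k + d, ?_⟩
    convert hy using 1
    push_cast
    rw [pow_succ']
    linear_combination e

theorem notMem_K_of_mem_Ioo {q : ℕ} {A : Finset ℕ} (hAq : A ⊆ Finset.range q) (hq : 0 < q)
    {b : ℕ} (hb : b ∉ A) {x : ℝ} (hx : x ∈ Set.Ioo ((b : ℝ) / q) ((b + 1) / q)) : x ∉ K q A := by
  intro hK
  obtain ⟨-, -, d, hd, y, hy, e⟩ := exists_digit_mem_K hAq hK
  obtain ⟨hy0, hy1, -⟩ := exists_digit_mem_K hAq hy
  have hq0 : (0 : ℝ) < q := by exact_mod_cast hq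
  have h1 := (div_lt_iff₀ hq0).1 hx.1
  have h2 := (lt_div_iff₀ hq0).1 hx.2
  have h3 : (d : ℝ) < b + 1 := by linarith
  have h4 : (b : ℝ) < d + 1 := by linarith
  have h5 : d < b + 1 := by exact_mod_cast h3
  have h6 : b < d + 1 := by exact_mod_cast h4
  exact hb ((show d = b by omega) ▸ hd)

/-- If a translate of `q ^ j * x` by an integer lies in the gap of a missing digit,
then `x` is not in `K q A`. -/
theorem notMem_K_of_pow_mul_sub_mem_Ioo {q : ℕ} {A : Finset ℕ} (hAq : A ⊆ Finset.range q)
    {b : ℕ} (hbq : b < q) (hb : b ∉ A) {x : ℝ} {j : ℕ} {k : ℤ}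
    (hx : (q : ℝ) ^ j * x - k ∈ Set.Ioo ((b : ℝ) / q) ((b + 1) / q)) : x ∉ K q A := by
  intro hK
  have hq0 : (0 : ℝ) < q := by exact_mod_cast (by omega : 0 < q)
  obtain ⟨k', hk'⟩ := exists_int_pow_mul_sub_mem_K hAq hK j
  obtain ⟨h0, h1, -⟩ := exists_digit_mem_K hAq hk'
  have h2 : 0 < (q : ℝ) ^ j * x - k := lt_of_le_of_lt (by positivity) hx.1
  have h3 : (q : ℝ) ^ j * x - k < 1 := hx.2.trans_le <| by
    rw [div_le_one hq0]; exact_mod_cast hbq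
  have h4 : (k : ℝ) < k' + 1 := by linarith
  have h5 : (k' : ℝ) < k + 1 := by linarith
  have h6 : k < k' + 1 := by exact_mod_cast h4
  have h7 : k' < k + 1 := by exact_mod_cast h5
  obtain rfl : k = k' := by omega
  exact notMem_K_of_mem_Ioo hAq (by omega) hb hx hk'

/-- Exponents of `c` in the denominators (supported on the primes of `B`) of fractions with
numerator `a` lying in `K q A` are bounded. -/
theorem exists_bound_of_div_mem_K_s12 {q : ℕ} (hq : 3 ≤ q) {A : Finset ℕ} (hAq : A ⊆ Finset.range q)
    (hA : A.card < q) {c B a : ℕ} (hc : c.Prime) (hcq : ¬ c ∣ q) (hcB : c ∣ B) (hB : B ≠ 0)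
    (ha : a ≠ 0) :
    ∃ N : ℕ, ∀ D e : ℕ, D ≠ 0 → (∀ l : ℕ, l.Prime → l ∣ D → l ∣ B) → c ^ e ∣ D →
      (a : ℝ) / D ∈ K q A → e ≤ N := by
  obtain ⟨b, hbq, hbA⟩ := Finset.exists_mem_notMem_of_card_lt_card
    (show A.card < (Finset.range q).card by simpa using hA)
  rw [Finset.mem_range] at hbq
  obtain ⟨T, hT0, hT⟩ := exists_prime_sq_dvd_pow_sub_one q B hB
  have hcp := Nat.prime_iff_prime_int.1 hc
  have hY : (q : ℤ) ^ T - 1 ≠ 0 := by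
    have : (1 : ℤ) < (q : ℤ) ^ T := one_lt_pow₀ (by exact_mod_cast (by omega : 1 < q)) hT0
    omega
  obtain ⟨g, hg, hcg⟩ :=
    (FiniteMultiplicity.of_prime_left hcp hY).exists_eq_pow_mul_and_not_dvd
  set w := multiplicity (c : ℤ) ((q : ℤ) ^ T - 1)
  have hw : 2 ≤ w := by
    by_contra! hlt
    have h1 := hT c hc hcB hcq
    rw [hg] at h1
    have h2 : (c : ℤ) ^ (w + 1) ∣ c ^ w * g := (pow_dvd_pow _ (by omega)).trans h1
    rw [pow_succ] at h2
    exact hcg ((mul_dvd_mul_iff_left (pow_ne_zero _ hcp.ne_zero)).1 h2)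
  obtain ⟨f, a', hca', rfl⟩ := Nat.exists_eq_pow_mul_and_not_dvd ha c hc.ne_one
  refine ⟨f + w + 2 * q, fun D e hD hDB heD hmem => ?_⟩
  by_contra! hlt
  obtain ⟨Q, R, m, rfl, ⟨Q', hQ'⟩, hR⟩ := Nat.exists_mul_eq_dvd_pow_coprime q D hD
  have hcqm : ∀ m, ¬ c ∣ q ^ m := fun m h => hcq (hc.dvd_of_dvd_pow h)
  have hceR : c ^ e ∣ R := by
    refine Nat.Coprime.dvd_of_dvd_mul_left (Nat.Coprime.pow_left e ?_) heD
    rw [hc.coprime_iff_not_dvd]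
    exact fun h => hcqm m (h.trans ⟨Q', hQ'⟩)
  have hR0 : R ≠ 0 := by rintro rfl; simp at hD
  have hQ0 : Q ≠ 0 := by rintro rfl; simp at hD
  obtain ⟨n, E, hcE, rfl⟩ := Nat.exists_eq_pow_mul_and_not_dvd hR0 c hc.ne_one
  have hen : e ≤ n := by
    by_contra! hne
    have h2 : c ^ n * c ∣ c ^ n * E := by
      rw [← pow_succ]; exact (pow_dvd_pow _ (by omega)).trans hceR
    exact hcE ((mul_dvd_mul_iff_left (pow_ne_zero _ hc.ne_zero)).1 h2)
  have hE0 : E ≠ 0 := by rintro rfl; simp at hcE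
  have hE : ∀ p : ℕ, p.Prime → p ∣ E → (p : ℤ) ∣ (q : ℤ) ^ T - 1 := fun l hl hlE =>
    (dvd_pow_self _ two_ne_zero).trans <| hT l hl (hDB l hl ((hlE.mul_left _).mul_left _)) fun hlq =>
      hl.one_lt.ne' <| Nat.dvd_one.1 <| hR ▸ Nat.dvd_gcd (hlE.mul_left _) hlq
  obtain ⟨n, rfl⟩ : ∃ n', n = f + n' := ⟨n - f, by omega⟩
  have hu : ¬ (c : ℤ) ∣ ((Q' * a' : ℕ) : ℤ) := by
    norm_cast
    rw [hc.dvd_mul]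
    rintro (h | h)
    · exact hcqm m (hQ' ▸ h.mul_left Q)
    · exact hca' h
  obtain ⟨j, k, hjk⟩ := exists_pow_mul_mem_Ioo (by omega) hc hw hg hcg hcE hE (n := n) (by omega)
    hu b
  refine notMem_K_of_pow_mul_sub_mem_Ioo hAq hbq hbA (j := j + m) (k := k) ?_ hmem
  convert hjk using 2
  have hQr : (q : ℝ) ^ m = Q * Q' := by exact_mod_cast hQ'
  have hc0 : (c : ℝ) ≠ 0 := by exact_mod_cast hc.ne_zero
  have hQ0' : (Q : ℝ) ≠ 0 := by exact_mod_cast hQ0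
  have hE0' : (E : ℝ) ≠ 0 := by exact_mod_cast hE0
  rw [pow_add, hQr]
  push_cast
  rw [pow_add]
  field_simp

theorem stmt_12 (q : ℕ) (hq : 3 ≤ q) (A : Finset ℕ) (hAq : A ⊆ Finset.range q)
    (hA1 : 1 < A.card) (hA2 : A.card < q)
    (ℓ : ℕ) (p : Fin ℓ → ℕ) (hp : ∀ j, 2 ≤ p j)
    (hfac : ∀ j, ∃ c : ℕ, c.Prime ∧ c ∣ p j ∧ ¬ c ∣ q)
    (α : ℚ) (hα : 0 < α) :
    {k : Fin ℓ → ℕ | ((α : ℝ) / ∏ j, (p j : ℝ) ^ (k j)) ∈ K q A}.Finite := by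
  have hp0 : ∀ j, p j ≠ 0 := fun j => by have := hp j; omega
  choose c hc hcp hcq using hfac
  have hB : α.den * ∏ j, p j ≠ 0 :=
    mul_ne_zero α.den_ne_zero (Finset.prod_ne_zero_iff.2 fun j _ => hp0 j)
  have ha : α.num.toNat ≠ 0 := by
    have := Rat.num_pos.2 hα
    omega
  have hpB : ∀ j, p j ∣ α.den * ∏ j, p j := fun j =>
    (Finset.dvd_prod_of_mem p (Finset.mem_univ j)).mul_left _
  choose N hN using fun j => exists_bound_of_div_mem_K_s12 hq hAq hA2 (hc j) (hcq j)
    ((hcp j).trans (hpB j)) hB ha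
  refine (Set.finite_Iic N).subset fun k hk j => ?_
  refine hN j (α.den * ∏ j, p j ^ k j) (k j) ?_ ?_ ?_ ?_
  · exact mul_ne_zero α.den_ne_zero
      (Finset.prod_ne_zero_iff.2 fun j _ => pow_ne_zero _ (hp0 j))
  · intro l hl hld
    rcases hl.dvd_mul.1 hld with h | h
    · exact h.mul_right _
    · obtain ⟨i, -, hi⟩ := (Prime.dvd_finsetProd_iff hl.prime _).1 h
      exact (hl.dvd_of_dvd_pow hi).trans (hpB i)
  · exact ((pow_dvd_pow_of_dvd (hcp j) _).trans
      (Finset.dvd_prod_of_mem (fun j => p j ^ k j) (Finset.mem_univ j))).mul_left _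
  · have hnum : ((α.num.toNat : ℕ) : ℝ) = (α.num : ℝ) := by
      exact_mod_cast Int.toNat_of_nonneg (Rat.num_nonneg.2 hα.le)
    have hk' : ((α : ℝ) / ∏ j, (p j : ℝ) ^ (k j)) ∈ K q A := hk
    convert hk' using 1
    rw [hnum]
    push_cast
    rw [← div_div, Rat.cast_def]
end

section
/- Let q ≥ 3 and p ≥ 2 be integers with gcd(p,q) = 1. Then for all but finitely many x in D_p the following holds: for every digit j ∈ {0,1,...,q-1}, x does not belong to K(q, {0,1,...,q-1}\{j}); that is, every q-adic expansion of x contains all possible digits 0, 1, ..., q-1. Here D_p = { Σ_{i=1}^n d_i/p^i : d_i ∈ {0,1,...,p-1} for all 1 ≤ i ≤ n, n ∈ ℕ }. -/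
theorem exists_one_add_pow_eq (e n : ℕ) : ∃ u, (1 + e) ^ n = 1 + e * u := by
  induction n with
  | zero => exact ⟨0, by simp⟩
  | succ n ih =>
    obtain ⟨u, hu⟩ := ih
    exact ⟨1 + u + e * u, by rw [pow_succ, hu]; ring⟩

theorem exists_geom_sum_one_add_eq (e n : ℕ) :
    ∃ u, ∑ i ∈ Finset.range n, (1 + e) ^ i = n + e * u := by
  induction n with
  | zero => exact ⟨0, by simp⟩
  | succ n ih =>
    obtain ⟨u, hu⟩ := ih
    obtain ⟨v, hv⟩ := exists_one_add_pow_eq e n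
    exact ⟨u + v, by rw [Finset.sum_range_succ, hu, hv]; ring⟩

theorem geom_sum_range_add (Q a b : ℕ) :
    ∑ i ∈ Finset.range (a + b), Q ^ i =
      ∑ i ∈ Finset.range a, Q ^ i + Q ^ a * ∑ i ∈ Finset.range b, Q ^ i := by
  rw [Finset.sum_range_add, Finset.mul_sum]
  simp only [pow_add]

theorem geom_sum_range_mul (Q a b : ℕ) :
    ∑ i ∈ Finset.range (a * b), Q ^ i =
      (∑ i ∈ Finset.range a, Q ^ i) * ∑ i ∈ Finset.range b, (Q ^ a) ^ i := by
  induction b with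
  | zero => simp
  | succ b ih =>
    rw [Nat.mul_succ, geom_sum_range_add, ih, Finset.sum_range_succ, pow_mul]
    ring

/-- If `Q ≡ 1` modulo `p ^ 2` and `M` divides a power of `p`, then `M` divides the geometric sum
`1 + Q + ⋯ + Q ^ (d - 1)` only if `M` divides `d`. -/
theorem dvd_of_dvd_geom_sum (p c n M : ℕ) (hM : M ∣ p ^ n) (hM0 : M ≠ 0) (d : ℕ)
    (h : M ∣ ∑ i ∈ Finset.range d, (1 + p ^ 2 * c) ^ i) : M ∣ d := by
  induction M using Nat.strong_induction_on generalizing d with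
  | _ M ih =>
  by_cases h1 : M = 1
  · simp [h1]
  obtain ⟨l, hl, M', rfl⟩ := Nat.exists_prime_and_dvd h1
  obtain ⟨p', hp'⟩ : l ∣ p := hl.dvd_of_dvd_pow ((Dvd.intro _ rfl).trans hM)
  have hld : l ∣ d := by
    obtain ⟨u, hu⟩ := exists_geom_sum_one_add_eq (p ^ 2 * c) d
    rw [hu] at h
    have h2 : l ∣ p ^ 2 * c * u := ⟨p' * p * c * u, by rw [hp']; ring⟩
    exact (Nat.dvd_add_left h2).mp ((Dvd.intro _ rfl).trans h)
  obtain ⟨d', rfl⟩ := hld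
  have hM'0 : M' ≠ 0 := by rintro rfl; simp at hM0
  have hM' : M' ∣ p ^ n := (Dvd.intro_left _ rfl).trans hM
  refine mul_dvd_mul_left l (ih M' ?_ hM' hM'0 d' ?_)
  · exact lt_mul_of_one_lt_left (Nat.pos_of_ne_zero hM'0) hl.one_lt
  obtain ⟨v, hv⟩ := exists_one_add_pow_eq (p ^ 2 * c) d'
  obtain ⟨u, hu⟩ := exists_geom_sum_one_add_eq (p ^ 2 * c * v) l
  have hS : ∑ i ∈ Finset.range l, (1 + p ^ 2 * c * v) ^ i = l * (1 + p * (p' * c * v * u)) := by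
    rw [hu, hp']; ring
  rw [mul_comm l d', geom_sum_range_mul, hv, hS, mul_left_comm] at h
  have h3 := Nat.dvd_of_mul_dvd_mul_left hl.pos h
  refine Nat.Coprime.dvd_of_dvd_mul_right ?_ h3
  refine Nat.Coprime.coprime_dvd_left hM' (Nat.Coprime.pow_left n ?_)
  simp

/-- Under the same hypotheses, the geometric sums of `Q` cover all residues modulo `M`. -/
theorem exists_geom_sum_eq_zmod (p c n M : ℕ) (hM : M ∣ p ^ n) (hM0 : M ≠ 0) (s : ZMod M) :
    ∃ k : ℕ, ((∑ i ∈ Finset.range k, (1 + p ^ 2 * c) ^ i : ℕ) : ZMod M) = s := by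
  have : NeZero M := ⟨hM0⟩
  let f : ZMod M → ZMod M := fun k ↦
    ((∑ i ∈ Finset.range k.val, (1 + p ^ 2 * c) ^ i : ℕ) : ZMod M)
  have hcop : Nat.Coprime M (1 + p ^ 2 * c) := by
    refine Nat.Coprime.coprime_dvd_left hM (Nat.Coprime.pow_left n ?_)
    rw [pow_two, mul_assoc]
    simp
  have key : ∀ a b : ZMod M, a.val ≤ b.val → f a = f b → a = b := by
    intro a b hab h
    obtain ⟨e, he⟩ := Nat.exists_eq_add_of_le hab
    simp only [f] at h
    rw [he, geom_sum_range_add, Nat.cast_add, left_eq_add, ZMod.natCast_eq_zero_iff] at h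
    have h1 := dvd_of_dvd_geom_sum p c n M hM hM0 e
      ((hcop.pow_right _).dvd_of_dvd_mul_left h)
    have h2 : e < M := by have := ZMod.val_lt b; omega
    have h3 : e = 0 := Nat.eq_zero_of_dvd_of_lt h1 h2
    exact ZMod.val_injective M (by omega)
  have hinj : Function.Injective f := fun a b h ↦
    (le_total a.val b.val).elim (fun hab ↦ key a b hab h) fun hab ↦ (key b a hab h.symm).symm
  obtain ⟨k, hk⟩ := Finite.injective_iff_surjective.mp hinj s
  exact ⟨k.val, hk⟩

theorem exists_mul_pow_modEq (p c n m b : ℕ) (hm : m ∣ p ^ n) (hm0 : m ≠ 0)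
    (hb : b.Coprime m) (u : ℤ) :
    ∃ (k : ℕ) (z : ℤ),
      (b : ℤ) * (1 + p ^ 2 * c : ℕ) ^ k = b + (p ^ 2 * c : ℕ) * u + m * z := by
  obtain ⟨k, hk⟩ := exists_geom_sum_eq_zmod p c n m hm hm0 ((b : ZMod m)⁻¹ * (u : ZMod m))
  have hbu : (b : ZMod m) * (b : ZMod m)⁻¹ = 1 := ZMod.coe_mul_inv_eq_one b hb
  have hg : ((p ^ 2 * c : ℕ) : ℤ) * ((∑ i ∈ Finset.range k, (1 + p ^ 2 * c) ^ i : ℕ) : ℤ) =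
      ((1 + p ^ 2 * c : ℕ) : ℤ) ^ k - 1 := by
    have := mul_geom_sum ((1 + p ^ 2 * c : ℕ) : ℤ) k
    rw [← this]
    push_cast
    ring
  have h : ((m : ℕ) : ℤ) ∣
      (b : ℤ) * (1 + p ^ 2 * c : ℕ) ^ k - (b + (p ^ 2 * c : ℕ) * u) := by
    rw [← ZMod.intCast_zmod_eq_zero_iff_dvd, ← sub_add_cancel (((1 + p ^ 2 * c : ℕ) : ℤ) ^ k) 1,
      ← hg]
    simp only [Int.cast_sub, Int.cast_add, Int.cast_mul, Int.cast_natCast, Int.cast_one, hk]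
    linear_combination ((p ^ 2 * c : ℕ) : ZMod m) * (u : ZMod m) * hbu
  obtain ⟨z, hz⟩ := h
  exact ⟨k, z, by rw [← hz]; ring⟩

/-- A number omitting the digit `j` in some `q`-adic expansion has no `q ^ k`-multiple lying,
modulo one, strictly between `j / q` and `(j + 1) / q`. -/
theorem not_mem_Ioo_of_mem_K {q j : ℕ} (hq : 0 < q) (hj : j < q) {x : ℝ}
    (hx : x ∈ K q (Finset.range q \ {j})) (k : ℕ) (z : ℤ) :
    (q : ℝ) ^ k * x - z ∉ Set.Ioo ((j : ℝ) / q) ((j + 1) / q) := by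
  obtain ⟨d, hd, rfl⟩ := hx
  simp only [Finset.mem_sdiff, Finset.mem_range, Finset.mem_singleton] at hd
  have hq' : (0 : ℝ) < q := by exact_mod_cast hq
  let a : ℕ → Fin q := fun i ↦ ⟨d i, (hd i).1⟩
  have hstep (k : ℕ) : (q : ℝ) * Real.ofDigits (fun i ↦ a (i + k)) =
      d k + Real.ofDigits (fun i ↦ a (i + (k + 1))) := by
    rw [Real.ofDigits_eq_sum_add_ofDigits _ 1]
    simp only [Finset.sum_range_one, Real.ofDigitsTerm, a]
    have : ∀ i, i + 1 + k = i + (k + 1) := fun i ↦ by ring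
    simp only [this, zero_add, pow_one]
    field_simp
  have hexp (k : ℕ) : ∃ I : ℤ, (q : ℝ) ^ k * Real.ofDigits a =
      I + Real.ofDigits (fun i ↦ a (i + k)) := by
    induction k with
    | zero => exact ⟨0, by simp⟩
    | succ k ih =>
      obtain ⟨I, hI⟩ := ih
      refine ⟨q * I + d k, ?_⟩
      rw [pow_succ', mul_assoc, hI, mul_add, hstep]
      push_cast
      ring
  have hval : ∑' i : ℕ, (d i : ℝ) / (q : ℝ) ^ (i + 1) = Real.ofDigits a := rfl
  rw [hval]
  rintro ⟨h1, h2⟩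
  obtain ⟨I, hI⟩ := hexp k
  rw [hI, div_lt_iff₀ hq'] at h1
  rw [hI, lt_div_iff₀ hq'] at h2
  have h3 := hstep k
  have h0 := Real.ofDigits_nonneg (fun i ↦ a (i + (k + 1)))
  have h4 := Real.ofDigits_le_one (fun i ↦ a (i + (k + 1)))
  have e1 : (j : ℤ) < q * (I - z) + d k + 1 := by
    have : (j : ℝ) < q * (I - z) + d k + 1 := by linarith
    exact_mod_cast this
  have e2 : q * (I - z) + d k < (j : ℤ) + 1 := by
    have : (q : ℝ) * (I - z) + d k < j + 1 := by linarith
    exact_mod_cast this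
  have e3 : (j : ℤ) = d k + q * (I - z) := by omega
  have e4 := congrArg (· % (q : ℤ)) e3
  simp only [Int.add_mul_emod_self_left] at e4
  have := hd k
  rw [Int.emod_eq_of_lt (by omega) (by omega), Int.emod_eq_of_lt (by omega) (by omega)] at e4
  omega

theorem exists_one_add_sq_mul_eq_pow {p q : ℕ} (hp : 2 ≤ p) (hq : 2 ≤ q) (hpq : Nat.gcd p q = 1) :
    ∃ t c : ℕ, 0 < c ∧ q ^ t = 1 + p ^ 2 * c := by
  have hφ : 0 < Nat.totient (p ^ 2) := Nat.totient_pos.mpr (by positivity)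
  have hlt : 1 < q ^ Nat.totient (p ^ 2) := Nat.one_lt_pow hφ.ne' hq
  have hmod : q ^ Nat.totient (p ^ 2) ≡ 1 [MOD p ^ 2] :=
    Nat.ModEq.pow_totient (Nat.Coprime.pow_right 2 (Nat.Coprime.symm hpq))
  obtain ⟨c, hc⟩ := (Nat.modEq_iff_dvd' hlt.le).mp hmod.symm
  refine ⟨Nat.totient (p ^ 2), c, Nat.pos_of_ne_zero ?_, by omega⟩
  rintro rfl
  omega

theorem stmt_13 (q p : ℕ) (hq : 3 ≤ q) (hp : 2 ≤ p) (hpq : Nat.gcd p q = 1) :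
    {x ∈ D p | ∃ j < q, x ∈ K q (Finset.range q \ {j})}.Finite := by
  obtain ⟨t, c, hc, ht⟩ := exists_one_add_sq_mul_eq_pow hp (by omega) hpq
  set N := p ^ 2 * c with hN
  have hN0 : 0 < N := by positivity
  refine Set.Finite.subset (((Set.finite_Iic (q * N)).prod (Set.finite_Iic (q * N))).image
    fun y : ℕ × ℕ ↦ (y.1 : ℝ) / y.2) ?_
  rintro x ⟨⟨a, n, han, rfl⟩, j, hj, hx⟩
  have hpn : 0 < p ^ n := by positivity
  obtain ⟨g, b, m, hg, hcop, rfl, hm⟩ := Nat.exists_coprime' (Nat.gcd_pos_of_pos_right a hpn)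
  have hm0 : 0 < m := Nat.pos_of_ne_zero (by rintro rfl; simp at hm; omega)
  have hmR : (0 : ℝ) < m := by exact_mod_cast hm0
  have hgR : (g : ℝ) ≠ 0 := by exact_mod_cast hg.ne'
  have hbm : b ≤ m := by
    rw [hm] at han
    exact Nat.le_of_mul_le_mul_right han hg
  have hval : ((b * g : ℕ) : ℝ) / (p : ℝ) ^ n = b / m := by
    have : (p : ℝ) ^ n = m * g := by exact_mod_cast hm
    rw [this, Nat.cast_mul, mul_div_mul_right _ _ hgR]
  rw [hval] at hx ⊢
  suffices hmN : m ≤ q * N from ⟨(b, m), ⟨hbm.trans hmN, hmN⟩, rfl⟩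
  by_contra! hlt
  have hqR : (0 : ℝ) < q := by exact_mod_cast (by omega : 0 < q)
  have hNR : (0 : ℝ) < N := by exact_mod_cast hN0
  have hltR : (q : ℝ) * N < m := by exact_mod_cast hlt
  set u : ℤ := ⌊((j : ℝ) * m / q - b) / N⌋ + 1 with hu
  have hu1 : (j : ℝ) * m / q - b < N * u := by
    have := Int.lt_floor_add_one (((j : ℝ) * m / q - b) / N)
    rw [div_lt_iff₀ hNR] at this
    rw [hu]
    push_cast
    linarith
  have hu2 : N * (u : ℝ) ≤ (j : ℝ) * m / q - b + N := by
    have := Int.floor_le (((j : ℝ) * m / q - b) / N)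
    rw [le_div_iff₀ hNR] at this
    rw [hu]
    push_cast
    linarith
  obtain ⟨k, z, hkz⟩ := exists_mul_pow_modEq p c n m b ⟨g, hm⟩ hm0.ne' hcop u
  rw [← hN, ← ht] at hkz
  have hkzR : (b : ℝ) * (q ^ t) ^ k = b + N * u + m * z := by exact_mod_cast hkz
  refine not_mem_Ioo_of_mem_K (by omega) hj hx (t * k) z ?_
  have hform : (q : ℝ) ^ (t * k) * (b / m) - z = (b + N * u) / m := by
    rw [pow_mul]
    field_simp
    linarith
  rw [hform]
  constructor
  · rw [lt_div_iff₀ hmR, div_mul_eq_mul_div]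
    linarith
  · rw [div_lt_div_iff₀ hmR hqR]
    have h5 : (j : ℝ) * m / q * q = j * m := by field_simp
    nlinarith
end

section
/- Let q ≥ 3 be an integer and let r = s/t ∈ (0,1) be a rational with gcd(s,t) = 1 such that t has a prime factor that does not divide q. Then for any positive rational α there exists k_α ∈ ℕ such that for every k ≥ k_α and every digit j ∈ {0,1,...,q-1}, the number α r^k does not belong to K(q, {0,1,...,q-1}\{j}); that is, every q-adic expansion of α r^k contains all possible digits 0, 1, ..., q-1. -/
/-- Every multiple of a real whose expansion omits the digit `j` by a power of `q` avoids,
modulo `1`, the interior of the `j`-th `q`-adic interval. -/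
theorem not_mem_digit_interval_of_mem_K {q j : ℕ} (hq : 2 ≤ q) (hj : j < q) {x : ℝ}
    (hx : x ∈ K q (Finset.range q \ {j})) (m : ℕ) (z : ℤ) :
    ¬ ((j : ℝ) < q * (q ^ m * x - z) ∧ q * (q ^ m * x - z) < j + 1) := by
  obtain ⟨d, hd, rfl⟩ := hx
  have hq1 : (1 : ℝ) < q := by exact_mod_cast hq
  have hq0 : (0 : ℝ) < q := by linarith
  have hdq : ∀ i, d i < q ∧ d i ≠ j := fun i => by simpa using hd i
  have hgeo : HasSum (fun i : ℕ => ((q : ℝ) - 1) / (q : ℝ) ^ (i + 1)) 1 := by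
    have h := (hasSum_geometric_of_lt_one (inv_nonneg.2 hq0.le) (inv_lt_one_of_one_lt₀ hq1)).mul_left
      (((q : ℝ) - 1) / q)
    have h1 : (q : ℝ) - 1 ≠ 0 := by linarith
    have hf : ∀ i : ℕ, ((q : ℝ) - 1) / q * (q : ℝ)⁻¹ ^ i = ((q : ℝ) - 1) / (q : ℝ) ^ (i + 1) := by
      intro i
      rw [inv_pow, pow_succ]
      field_simp
    have hv : ((q : ℝ) - 1) / q * (1 - (q : ℝ)⁻¹)⁻¹ = 1 := by
      have : 1 - (q : ℝ)⁻¹ = ((q : ℝ) - 1) / q := by field_simp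
      rw [this, mul_inv_cancel₀ (by positivity)]
    rwa [funext hf, hv] at h
  have hle : ∀ n i, (d (i + n) : ℝ) / (q : ℝ) ^ (i + 1) ≤ ((q : ℝ) - 1) / (q : ℝ) ^ (i + 1) := by
    intro n i
    have : (d (i + n) : ℝ) + 1 ≤ q := by exact_mod_cast (hdq (i + n)).1
    gcongr
    linarith
  have hnn : ∀ n i, 0 ≤ (d (i + n) : ℝ) / (q : ℝ) ^ (i + 1) := fun n i => by positivity
  have hsum : ∀ n, Summable fun i => (d (i + n) : ℝ) / (q : ℝ) ^ (i + 1) := fun n =>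
    Summable.of_nonneg_of_le (hnn n) (hle n) hgeo.summable
  set T : ℕ → ℝ := fun n => ∑' i, (d (i + n) : ℝ) / (q : ℝ) ^ (i + 1) with hT
  have hT0 : ∀ n, 0 ≤ T n := fun n => tsum_nonneg (hnn n)
  have hT1 : ∀ n, T n ≤ 1 := fun n => by
    rw [← hgeo.tsum_eq]
    exact (hsum n).tsum_le_tsum (hle n) hgeo.summable
  have hstep : ∀ n, q * T n = d n + T (n + 1) := by
    intro n
    simp only [hT]
    rw [(hsum n).tsum_eq_zero_add, mul_add, ← tsum_mul_left]
    congr 1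
    · simp only [zero_add, pow_one]
      field_simp
    · refine tsum_congr fun i => ?_
      rw [show i + 1 + n = i + (n + 1) by ring, pow_succ]
      field_simp
  have hint : ∀ n, ∃ w : ℤ, (q : ℝ) ^ n * T 0 = w + T n := by
    intro n
    induction n with
    | zero => exact ⟨0, by simp⟩
    | succ n ih =>
      obtain ⟨w, hw⟩ := ih
      refine ⟨q * w + d n, ?_⟩
      rw [pow_succ', mul_assoc, hw, mul_add, hstep]
      push_cast
      ring
  rintro ⟨h1, h2⟩
  obtain ⟨w, hw⟩ := hint m
  change (j : ℝ) < q * (q ^ m * T 0 - z) at h1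
  change q * (q ^ m * T 0 - z) < (j : ℝ) + 1 at h2
  have hs := hstep m
  have heq : q * (q ^ m * T 0 - z) = ((q * (w - z) + d m : ℤ) : ℝ) + T (m + 1) := by
    rw [hw]
    push_cast
    linear_combination hs
  rw [heq] at h1 h2
  have e1 : (q * (w - z) + d m : ℤ) < j + 1 := by
    have := hT0 (m + 1)
    have : ((q * (w - z) + d m : ℤ) : ℝ) < ((j + 1 : ℤ) : ℝ) := by push_cast at *; linarith
    exact_mod_cast this
  have e2 : (j : ℤ) - 1 < (q * (w - z) + d m : ℤ) := by
    have := hT1 (m + 1)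
    have : ((j - 1 : ℤ) : ℝ) < ((q * (w - z) + d m : ℤ) : ℝ) := by push_cast at *; linarith
    exact_mod_cast this
  have hD : (d m : ℤ) + q * (w - z) = j := by
    linarith [Int.le_sub_one_of_lt e1, Int.add_one_le_of_lt e2]
  have hmod : (d m : ℤ) % q = j % q := by rw [← hD, Int.add_mul_emod_self_left]
  exact (hdq m).2 (by
    rw [Int.emod_eq_of_lt (by positivity) (by exact_mod_cast (hdq m).1),
      Int.emod_eq_of_lt (by positivity) (by exact_mod_cast hj)] at hmod
    exact_mod_cast hmod)

/-- If multiplication by `Q` rotates `y` modulo `1` by `u / N` with `u` a unit modulo `N`, and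
`Q ≡ 1 [MOD N]` with `N > q`, then the orbit of `y` meets every `q`-adic interval of length
`1 / q`. -/
theorem exists_pow_mul_mem_digit_interval {q N Q : ℕ} (hq : 0 < q) (hN : q < N) {y : ℝ} {u : ℤ}
    (hu : IsCoprime u (N : ℤ)) (hQ : (N : ℤ) ∣ Q - 1) (hy : ((Q : ℝ) - 1) * y = u / N) (j : ℕ) :
    ∃ (h : ℕ) (z : ℤ), (j : ℝ) < q * (Q ^ h * y - z) ∧ q * (Q ^ h * y - z) < j + 1 := by
  have hN0 : (0 : ℝ) < N := by exact_mod_cast hq.trans hN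
  have hq0 : (0 : ℝ) < q := by exact_mod_cast hq
  have hqN : (q : ℝ) < N := by exact_mod_cast hN
  set Z : ℤ := ⌊((j : ℝ) / q - y) * N⌋ + 1 with hZ
  have hZ1 : ((j : ℝ) / q - y) * N < Z := by
    rw [hZ]; push_cast; exact Int.lt_floor_add_one _
  have hZ2 : (Z : ℝ) ≤ ((j : ℝ) / q - y) * N + 1 := by
    rw [hZ]; push_cast; linarith [Int.floor_le (((j : ℝ) / q - y) * N)]
  obtain ⟨h, hh⟩ : ∃ h : ℕ, (N : ℤ) ∣ h * u - Z := by
    obtain ⟨a, b, hab⟩ := hu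
    have hNz : (N : ℤ) ≠ 0 := by have := hq.trans hN; positivity
    refine ⟨(a * Z % N).toNat, ?_⟩
    rw [Int.toNat_of_nonneg (Int.emod_nonneg _ hNz), Int.emod_def]
    refine ⟨-b * Z - (a * Z / N) * u, ?_⟩
    linear_combination Z * hab
  obtain ⟨p, hp⟩ : (N : ℤ) ∣ (∑ i ∈ Finset.range h, (Q : ℤ) ^ i) - h := by
    have : (∑ i ∈ Finset.range h, (Q : ℤ) ^ i) - h =
        ∑ i ∈ Finset.range h, ((Q : ℤ) ^ i - 1) := by simp
    rw [this]
    exact Finset.dvd_sum fun i _ => hQ.trans (by simpa using sub_dvd_pow_sub_pow (Q : ℤ) 1 i)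
  obtain ⟨m, hm⟩ := hh
  have hpR : (∑ i ∈ Finset.range h, (Q : ℝ) ^ i) = h + N * p := by
    have : (∑ i ∈ Finset.range h, (Q : ℤ) ^ i) = h + N * p := by linarith
    exact_mod_cast this
  have hmR : (h : ℝ) * u = Z + N * m := by
    have : (h : ℤ) * u = Z + N * m := by linarith
    exact_mod_cast this
  have horb : (Q : ℝ) ^ h * y - ((m + p * u : ℤ) : ℝ) = y + Z / N := by
    have hg := geom_sum_mul (Q : ℝ) h
    have : (Q : ℝ) ^ h * y = y + (h + N * p) * (u / N) := by
      rw [← hy, ← hpR]; linear_combination -y * hg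
    rw [this]
    push_cast
    field_simp
    linear_combination hmR
  refine ⟨h, m + p * u, ?_⟩
  rw [horb]
  have e1 : (j : ℝ) / q < y + Z / N := by
    have := (lt_div_iff₀ hN0).2 hZ1
    linarith
  have e2 : y + Z / N < ((j : ℝ) + 1) / q := by
    have h1 : (Z : ℝ) / N ≤ (j : ℝ) / q - y + 1 / N := by
      rw [div_le_iff₀ hN0]
      field_simp at hZ2 ⊢
      linarith
    have h2 : (1 : ℝ) / N < 1 / q := one_div_lt_one_div_of_lt hq0 hqN
    rw [add_div]
    linarith
  constructor
  · rw [div_lt_iff₀ hq0] at e1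
    linarith
  · rw [lt_div_iff₀ hq0] at e2
    linarith

/-- Lifting the exponent, uniformly in the prime `c`. -/
theorem emultiplicity_pow_sub_one {c : ℕ} (hc : c.Prime) {x : ℤ} (h : (c : ℤ) ∣ x - 1)
    (h4 : c = 2 → (4 : ℤ) ∣ x - 1) (n : ℕ) :
    emultiplicity (c : ℤ) (x ^ n - 1) = emultiplicity (c : ℤ) (x - 1) + emultiplicity c n := by
  have hx : ¬ (c : ℤ) ∣ x := fun hx => by
    have h1 : (c : ℤ) ∣ 1 := by simpa using dvd_sub hx h
    exact hc.one_lt.ne' (by exact_mod_cast Int.eq_one_of_dvd_one (by positivity) h1)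
  rcases hc.eq_two_or_odd' with rfl | hodd
  · have := Int.two_pow_sub_pow' (x := x) (y := 1) n (h4 rfl) hx
    rw [one_pow] at this
    rw [← Int.natCast_emultiplicity]
    exact this
  · simpa using Int.emultiplicity_pow_sub_pow hc hodd h hx n

/-- Powers of `q` that are close to `1` at the prime `c` to a prescribed precision `E`, while
being `1` modulo the part of `G ^ k` coprime to `q`. -/
theorem exists_pow_eq_one_add_s14 {q c G : ℕ} (hq : 2 ≤ q) (hc : c.Prime) (hcq : ¬ c ∣ q)
    (hcG : ¬ c ∣ G) :
    ∃ a v : ℕ, ∀ k E : ℕ, v ≤ E → ∃ L w : ℕ,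
      q ^ L = 1 + c ^ E * w ∧ ¬ c ∣ w ∧ G ^ k ∣ q ^ (a * k) * w := by
  have hG0 : G ≠ 0 := by rintro rfl; simp at hcG
  have : NeZero G := ⟨hG0⟩
  obtain ⟨a, M, hM, haM⟩ : ∃ a M : ℕ, 0 < M ∧ G ∣ q ^ a * (q ^ M - 1) := by
    obtain ⟨i, j, hij, he⟩ :=
      Finite.exists_ne_map_eq_of_infinite (fun i : ℕ => ((q ^ i : ℕ) : ZMod G))
    wlog hlt : i < j generalizing i j
    · exact this j i hij.symm he.symm (by omega)
    refine ⟨i, j - i, by omega, ?_⟩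
    rw [Nat.mul_sub, mul_one, ← pow_add, Nat.add_sub_cancel' hlt.le]
    rw [ZMod.natCast_eq_natCast_iff] at he
    exact (Nat.modEq_iff_dvd' (Nat.pow_le_pow_right (by omega) hlt.le)).1 he
  obtain ⟨G₁, G₂, h₁, h₂, rfl⟩ := exists_dvd_and_dvd_of_dvd_mul haM
  have hcG₂ : ¬ c ∣ G₂ := fun h => hcG (h.mul_left _)
  have hcop : q.Coprime c := ((Nat.Prime.coprime_iff_not_dvd hc).2 hcq).symm
  set M₁ := M * (2 * (c - 1)) with hM₁
  have hc1 := hc.two_le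
  have hM₁0 : M₁ ≠ 0 := by
    have : 0 < c - 1 := by omega
    positivity
  have hdvd : ∀ d M', M' ∣ M₁ → (d : ℤ) ∣ (q : ℤ) ^ M' - 1 → (d : ℤ) ∣ (q : ℤ) ^ M₁ - 1 := by
    rintro d M' ⟨e, he⟩ h
    rw [he, pow_mul]
    exact h.trans (by simpa using sub_dvd_pow_sub_pow ((q : ℤ) ^ M') 1 e)
  have hx : (c : ℤ) ∣ (q : ℤ) ^ M₁ - 1 := by
    refine hdvd c (c - 1) ⟨M * 2, by rw [hM₁]; ring⟩ ?_
    have := Nat.ModEq.pow_totient hcop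
    rw [Nat.totient_prime hc] at this
    simpa using (Nat.modEq_iff_dvd.1 this.symm)
  have hx4 : c = 2 → (4 : ℤ) ∣ (q : ℤ) ^ M₁ - 1 := by
    rintro rfl
    refine hdvd 4 2 ⟨M, by rw [hM₁]; ring⟩ ?_
    obtain ⟨b, hb⟩ : Odd q := by rwa [← Nat.not_even_iff_odd, even_iff_two_dvd]
    exact ⟨b ^ 2 + b, by rw [hb]; push_cast; ring⟩
  have hxG : (G₂ : ℤ) ∣ (q : ℤ) ^ M₁ - 1 := by
    refine hdvd G₂ M ⟨_, hM₁⟩ ?_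
    have := Int.natCast_dvd_natCast.2 h₂
    rwa [Nat.cast_sub (Nat.one_le_pow _ _ (by omega)), Nat.cast_pow, Nat.cast_one] at this
  have hfin : FiniteMultiplicity (c : ℤ) ((q : ℤ) ^ M₁ - 1) := by
    refine Int.finiteMultiplicity_iff.2 ⟨by simpa using hc.one_lt.ne', ?_⟩
    have : 1 < q ^ M₁ := Nat.one_lt_pow hM₁0 (by omega)
    have : (1 : ℤ) < (q : ℤ) ^ M₁ := by exact_mod_cast this
    omega
  set v := multiplicity (c : ℤ) ((q : ℤ) ^ M₁ - 1) with hv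
  refine ⟨a, v, fun k E hE => ?_⟩
  set n := G₂ ^ k * c ^ (E - v) with hn
  have hmn : emultiplicity c n = (E - v : ℕ) := by
    rw [hn, emultiplicity_mul hc.prime, _root_.emultiplicity_pow hc.prime,
      emultiplicity_eq_zero.2 hcG₂, mul_zero, zero_add, emultiplicity_pow_self_of_prime hc.prime]
  have hmul : emultiplicity (c : ℤ) (((q : ℤ) ^ M₁) ^ n - 1) = (E : ℕ) := by
    rw [emultiplicity_pow_sub_one hc hx hx4, hmn, hfin.emultiplicity_eq_multiplicity, ← hv]
    norm_cast
    omega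
  have hone : 1 ≤ q ^ (M₁ * n) := Nat.one_le_pow _ _ (by omega)
  have hcast : (((q ^ (M₁ * n) - 1 : ℕ)) : ℤ) = ((q : ℤ) ^ M₁) ^ n - 1 := by
    rw [Nat.cast_sub hone, ← pow_mul]; push_cast; rfl
  rw [← hcast, Int.natCast_emultiplicity, emultiplicity_eq_coe] at hmul
  obtain ⟨⟨w, hw⟩, hmul2⟩ := hmul
  refine ⟨M₁ * n, w, by omega, ?_, ?_⟩
  · rintro ⟨w', rfl⟩
    exact hmul2 ⟨w', by rw [hw]; ring⟩
  · rw [mul_pow, pow_mul]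
    refine mul_dvd_mul (pow_dvd_pow_of_dvd h₁ k) ?_
    have hco : (G₂ ^ k).Coprime (c ^ E) :=
      Nat.Coprime.pow _ _ ((Nat.Prime.coprime_iff_not_dvd hc).2 hcG₂).symm
    refine hco.dvd_of_dvd_mul_left ?_
    rw [← hw, ← Int.natCast_dvd_natCast, hcast, hn, pow_mul]
    have h1 := dvd_sub_pow_of_dvd_sub hxG k
    rw [one_pow] at h1
    push_cast
    exact ((pow_dvd_pow _ k.le_succ).trans h1).trans
      (by simpa using sub_dvd_pow_sub_pow (((q : ℤ) ^ M₁) ^ G₂ ^ k) 1 (c ^ (E - v)))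

theorem stmt_14 (q : ℕ) (hq : 3 ≤ q)
    (r : ℚ) (hr0 : 0 < r) (hr1 : r < 1)
    (ht : ∃ c : ℕ, c.Prime ∧ c ∣ r.den ∧ ¬ c ∣ q)
    (α : ℚ) (hα : 0 < α) :
    ∃ kα : ℕ, ∀ k : ℕ, kα ≤ k → ∀ j < q,
      ((α * r ^ k : ℚ) : ℝ) ∉ K q (Finset.range q \ {j}) := by
  obtain ⟨c, hc, hct, hcq⟩ := ht
  have hcne : c ≠ 1 := hc.one_lt.ne'
  have hpc : Prime (c : ℤ) := Nat.prime_iff_prime_int.1 hc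
  obtain ⟨β, B, hB, hBe⟩ := Nat.exists_eq_pow_mul_and_not_dvd α.den_nz c hcne
  obtain ⟨τ, t, htc, hte⟩ := Nat.exists_eq_pow_mul_and_not_dvd r.den_nz c hcne
  have hA0 : α.num ≠ 0 := (Rat.num_pos.2 hα).ne'
  obtain ⟨A, hAe, hA⟩ := (Int.finiteMultiplicity_iff.2
    ⟨by simpa using hcne, hA0⟩ : FiniteMultiplicity (c : ℤ) α.num).exists_eq_pow_mul_and_not_dvd
  set γ := multiplicity (c : ℤ) α.num
  have hs : ¬ (c : ℤ) ∣ r.num := fun h =>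
    hc.not_dvd_one (r.reduced ▸ Nat.dvd_gcd (Int.natCast_dvd.1 h) hct)
  have hτ : 1 ≤ τ := by
    rcases Nat.eq_zero_or_pos τ with rfl | h
    · rw [hte] at hct; simp at hct; exact absurd hct htc
    · exact h
  have hcG : ¬ c ∣ B * t := fun h => (hc.dvd_mul.1 h).elim hB htc
  obtain ⟨a, v, hav⟩ := exists_pow_eq_one_add_s14 (by omega) hc hcq hcG
  refine ⟨γ + q + v + q + 1, fun k hk j hj hmem => ?_⟩
  obtain ⟨E, hE⟩ : ∃ E, E + γ + q = β + τ * k := by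
    have : k ≤ τ * k := Nat.le_mul_of_pos_left k hτ
    exact ⟨β + τ * k - γ - q, by omega⟩
  have hkτ : k ≤ τ * k := Nat.le_mul_of_pos_left k hτ
  obtain ⟨L, w, hL, hcw, m, hm⟩ := hav k E (by omega)
  obtain ⟨k', rfl⟩ : ∃ k', k = k' + 1 := ⟨k - 1, by omega⟩
  have hcm : ¬ c ∣ m := fun h => by
    have : c ∣ q ^ (a * (k' + 1)) * w := hm ▸ h.mul_left _
    exact (hc.dvd_mul.1 this).elim (fun h => hcq (hc.dvd_of_dvd_pow h)) hcw
  set u : ℤ := m * B ^ k' * A * r.num ^ (k' + 1) with hu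
  have hcu : ¬ (c : ℤ) ∣ u := fun h => by
    rcases hpc.dvd_or_dvd h with h | h
    · rcases hpc.dvd_or_dvd h with h | h
      · rcases hpc.dvd_or_dvd h with h | h
        · exact hcm (Int.natCast_dvd_natCast.1 h)
        · exact hB (Int.natCast_dvd_natCast.1 (hpc.dvd_of_dvd_pow h))
      · exact hA h
    · exact hs (hpc.dvd_of_dvd_pow h)
  have hucop : IsCoprime u ((c ^ q : ℕ) : ℤ) := by
    push_cast
    exact ((hpc.coprime_iff_not_dvd.2 hcu).symm).pow_right
  have hQ : ((c ^ q : ℕ) : ℤ) ∣ ((q ^ L : ℕ) : ℤ) - 1 := by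
    rw [hL]
    push_cast
    rw [add_sub_cancel_left]
    exact (pow_dvd_pow _ (by omega)).mul_right _
  have hy : (((q ^ L : ℕ) : ℝ) - 1) *
      ((q : ℝ) ^ (a * (k' + 1)) * ((α * r ^ (k' + 1) : ℚ) : ℝ)) = u / ((c ^ q : ℕ) : ℝ) := by
    have hc0 : (c : ℝ) ≠ 0 := by exact_mod_cast hc.ne_zero
    have hB0 : (B : ℝ) ≠ 0 := by rintro h; exact hB (by simp [Nat.cast_eq_zero.1 h])
    have ht0 : (t : ℝ) ≠ 0 := by rintro h; exact htc (by simp [Nat.cast_eq_zero.1 h])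
    have hαR : (α : ℝ) = (c : ℝ) ^ γ * A / ((c : ℝ) ^ β * B) := by
      rw [Rat.cast_def, hAe, hBe]; push_cast; rfl
    have hrR : (r : ℝ) = r.num / ((c : ℝ) ^ τ * t) := by
      conv_lhs => rw [Rat.cast_def, hte]
      push_cast; rfl
    have hmR : (q : ℝ) ^ (a * (k' + 1)) * w = ((B : ℝ) * t) ^ (k' + 1) * m := by
      exact_mod_cast hm
    have hER : (c : ℝ) ^ E * c ^ γ * c ^ q = c ^ β * (c ^ τ) ^ (k' + 1) := by
      rw [← pow_mul, ← pow_add, ← pow_add, ← pow_add, hE]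
    rw [hL, hu, Rat.cast_mul, Rat.cast_pow, hαR, hrR]
    push_cast
    rw [add_sub_cancel_left, div_pow, mul_pow]
    rw [eq_div_iff (by positivity), div_mul_div_comm, mul_div_assoc', mul_div_assoc',
      div_mul_eq_mul_div, div_eq_iff (by positivity)]
    calc _ = ((c : ℝ) ^ E * c ^ γ * c ^ q) * ((q : ℝ) ^ (a * (k' + 1)) * w) * A *
          r.num ^ (k' + 1) := by ring
      _ = _ := by rw [hER, hmR]; ring
  obtain ⟨h, z, hz⟩ := exists_pow_mul_mem_digit_interval (by omega) (Nat.lt_pow_self hc.one_lt)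
    hucop hQ hy j
  refine not_mem_digit_interval_of_mem_K (by omega) hj hmem (L * h + a * (k' + 1)) z ?_
  rw [pow_add, pow_mul, mul_assoc]
  push_cast at hz ⊢
  exact hz
end

section
/- There are only finitely many positive integers n such that 2^{-n} belongs to K(3,{0,1}), i.e., only finitely many n for which the ternary expansion of 2^{-n} omits the digit 2. -/
theorem div_three_pow_le_of_mem {a : ℕ} (ha : a ∈ ({0, 1} : Finset ℕ)) (i : ℕ) :
    (a : ℝ) / ((3 : ℕ) : ℝ) ^ (i + 1) ≤ 1 / 3 * (1 / 3) ^ i := by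
  have h : (a : ℝ) ≤ 1 := by
    simp only [Finset.mem_insert, Finset.mem_singleton] at ha
    rcases ha with h | h <;> simp [h]
  rw [← pow_succ', one_div_pow]
  push_cast
  gcongr

theorem hasSum_one_third_mul_one_third_pow :
    HasSum (fun i : ℕ => (1 / 3 : ℝ) * (1 / 3) ^ i) (1 / 2) := by
  have h : (1 / 2 : ℝ) = 1 / 3 * (1 - 1 / 3)⁻¹ := by norm_num
  rw [h]
  exact (hasSum_geometric_of_lt_one (by norm_num) (by norm_num)).mul_left _

theorem summable_div_three_pow {d : ℕ → ℕ} (hd : ∀ i, d i ∈ ({0, 1} : Finset ℕ)) :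
    Summable fun i : ℕ => (d i : ℝ) / ((3 : ℕ) : ℝ) ^ (i + 1) :=
  .of_nonneg_of_le (fun i => by positivity) (fun i => div_three_pow_le_of_mem (hd i) i)
    hasSum_one_third_mul_one_third_pow.summable

theorem nonneg_and_le_half_of_mem_K_three {x : ℝ} (hx : x ∈ K 3 ({0, 1} : Finset ℕ)) :
    0 ≤ x ∧ x ≤ 1 / 2 := by
  obtain ⟨d, hd, rfl⟩ := hx
  exact ⟨tsum_nonneg fun i => by positivity,
    hasSum_le (fun i => div_three_pow_le_of_mem (hd i) i) (summable_div_three_pow hd).hasSum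
      hasSum_one_third_mul_one_third_pow⟩

theorem exists_three_mul_eq_add_of_mem_K_three {x : ℝ} (hx : x ∈ K 3 ({0, 1} : Finset ℕ)) :
    ∃ m : ℕ, ∃ y ∈ K 3 ({0, 1} : Finset ℕ), 3 * x = m + y := by
  obtain ⟨d, hd, rfl⟩ := hx
  refine ⟨d 0, _, ⟨fun i => d (i + 1), fun i => hd _, rfl⟩, ?_⟩
  rw [(summable_div_three_pow hd).tsum_eq_zero_add, mul_add, ← tsum_mul_left]
  congr 1
  · norm_num
    ring
  · refine tsum_congr fun i => ?_
    push_cast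
    rw [pow_succ (3 : ℝ) (i + 1)]
    field_simp

theorem exists_three_pow_mul_eq_add_of_mem_K_three {x : ℝ} (hx : x ∈ K 3 ({0, 1} : Finset ℕ))
    (k : ℕ) : ∃ m : ℕ, ∃ y ∈ K 3 ({0, 1} : Finset ℕ), 3 ^ k * x = m + y := by
  induction k with
  | zero => exact ⟨0, x, hx, by simp⟩
  | succ k ih =>
    obtain ⟨m, y, hy, h⟩ := ih
    obtain ⟨l, z, hz, h'⟩ := exists_three_mul_eq_add_of_mem_K_three hy
    refine ⟨3 * m + l, z, hz, ?_⟩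
    push_cast
    linear_combination 3 * h + h'

theorem exists_three_pow_two_pow_eq (m : ℕ) :
    ∃ j : ℕ, 3 ^ 2 ^ (m + 1) = 1 + 2 ^ (m + 3) * (2 * j + 1) := by
  induction m with
  | zero => exact ⟨0, by norm_num⟩
  | succ m ih =>
    obtain ⟨j, hj⟩ := ih
    refine ⟨j + 2 ^ (m + 1) * (2 * j + 1) ^ 2, ?_⟩
    rw [pow_succ 2 (m + 1), pow_mul, hj]
    ring

theorem stmt_15 :
    {n : ℕ | 0 < n ∧ ((2 : ℝ) ^ n)⁻¹ ∈ K 3 ({0, 1} : Finset ℕ)}.Finite := by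
  refine (Set.finite_lt_nat 4).subset ?_
  rintro n ⟨-, hn⟩
  by_contra hlt
  rw [Set.mem_ofPred_eq, not_lt] at hlt
  obtain ⟨m, rfl⟩ := Nat.exists_eq_add_of_le' hlt
  obtain ⟨j, hj⟩ := exists_three_pow_two_pow_eq m
  obtain ⟨l, y, hy, h⟩ := exists_three_pow_mul_eq_add_of_mem_K_three hn (2 ^ (m + 1))
  obtain ⟨hy0, hy1⟩ := nonneg_and_le_half_of_mem_K_three hy
  have hj' : (3 : ℝ) ^ 2 ^ (m + 1) = 1 + 2 ^ (m + 3) * (2 * j + 1) := by exact_mod_cast hj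
  have hpos : (0 : ℝ) < ((2 : ℝ) ^ (m + 4))⁻¹ := by positivity
  have hsmall : ((2 : ℝ) ^ (m + 4))⁻¹ < 1 / 2 := by
    rw [inv_lt_comm₀ (by positivity) (by norm_num)]
    have : (1 : ℝ) ≤ 2 ^ m := one_le_pow₀ (by norm_num)
    rw [pow_add]
    norm_num
    linarith
  have key : (j : ℝ) + 1 / 2 + ((2 : ℝ) ^ (m + 4))⁻¹ = l + y := by
    rw [← h, hj', pow_succ (2 : ℝ) (m + 3)]
    field_simp
    ring
  have h1 : j < l := by
    have : (j : ℝ) < l := by linarith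
    exact_mod_cast this
  have h2 : l < j + 1 := by
    have : (l : ℝ) < j + 1 := by linarith
    exact_mod_cast this
  omega
end

section
/- Let q ≥ 3 be a prime number, A a subset of {0,1,...,q-1} with 1 < #A < q such that {0,1} ⊆ A or {0,q-1} ⊆ A, and let K(q,A) = { Σ_{i=1}^∞ d_i/q^i : d_i ∈ A for all i ∈ ℕ }. Let p ≥ 2 be an integer and let B_p be the topological closure of { p^{-k} : k ∈ ℕ } in ℝ. Then B_p ∩ K(q,A) is finite if and only if (log p)/(log q) is irrational. -/
/-- `B p` is the topological closure in `ℝ` of `{p^{-k} : k ∈ ℕ, k ≥ 1}`. -/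
def B (p : ℕ) : Set ℝ :=
  closure {x : ℝ | ∃ k : ℕ, 0 < k ∧ x = ((p : ℝ) ^ k)⁻¹}

open Real in
/-- Membership in `K q A` in terms of `Real.ofDigits`. -/
theorem mem_K_iff_exists_ofDigits {q : ℕ} {A : Finset ℕ} (hAq : A ⊆ Finset.range q) {x : ℝ} :
    x ∈ K q A ↔ ∃ d : ℕ → Fin q, (∀ i, (d i : ℕ) ∈ A) ∧ x = ofDigits d := by
  constructor
  · rintro ⟨d, hd, rfl⟩
    exact ⟨fun i => ⟨d i, Finset.mem_range.mp (hAq (hd i))⟩, hd, by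
      simp [ofDigits, ofDigitsTerm, div_eq_mul_inv]⟩
  · rintro ⟨d, hd, rfl⟩
    exact ⟨fun i => d i, hd, by simp [ofDigits, ofDigitsTerm, div_eq_mul_inv]⟩

open Real in
theorem mul_ofDigits_eq_head_add_tail {q : ℕ} (d : ℕ → Fin q) :
    (q : ℝ) * ofDigits d = (d 0 : ℕ) + ofDigits (fun i => d (i + 1)) := by
  have hq : (q : ℝ) ≠ 0 := by exact_mod_cast (Fin.pos (d 0)).ne'
  rw [ofDigits_eq_sum_add_ofDigits d 1]
  simp [ofDigitsTerm]
  field_simp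

open Real in
theorem exists_pow_mul_ofDigits_eq_int_add_tail {q : ℕ} (d : ℕ → Fin q) (n : ℕ) :
    ∃ z : ℤ, (q : ℝ) ^ n * ofDigits d = z + ofDigits (fun i => d (i + n)) := by
  induction n with
  | zero => exact ⟨0, by simp⟩
  | succ n ih =>
    obtain ⟨z, hz⟩ := ih
    refine ⟨q * z + (d n : ℕ), ?_⟩
    have := mul_ofDigits_eq_head_add_tail (fun i => d (i + n))
    simp only [zero_add, add_right_comm _ 1 n, add_assoc _ n 1] at this
    rw [pow_succ', mul_assoc, hz, mul_add, this]
    push_cast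
    ring

open Real in
/-- If `q ^ n * x` is congruent modulo `1` to a point in the interior of the cylinder of the
digit `a`, then `a` is one of the digits of `x`. -/
theorem mem_of_mem_K_of_lt_of_lt {q : ℕ} {A : Finset ℕ} (hAq : A ⊆ Finset.range q) {x y : ℝ}
    (hx : x ∈ K q A) {n : ℕ} {z : ℤ} (hy : (q : ℝ) ^ n * x = z + y) {a : ℕ} (haq : a < q)
    (h1 : (a : ℝ) < q * y) (h2 : q * y < (a : ℝ) + 1) : a ∈ A := by
  obtain ⟨d, hd, rfl⟩ := (mem_K_iff_exists_ofDigits hAq).mp hx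
  obtain ⟨w, hw⟩ := exists_pow_mul_ofDigits_eq_int_add_tail d n
  have hq0 : (0 : ℝ) < q := by exact_mod_cast (Nat.zero_le a).trans_lt haq
  have haq' : (a : ℝ) + 1 ≤ q := by exact_mod_cast haq
  have hy0 : 0 < y := pos_of_mul_pos_right (a := (q : ℝ))
    (by linarith [a.cast_nonneg (α := ℝ)]) hq0.le
  have hy1 : y < 1 := by
    by_contra! h
    nlinarith
  have hT0 := ofDigits_nonneg (fun i => d (i + n))
  have hT1 := ofDigits_le_one (fun i => d (i + n))
  have hzw : z = w := by
    have e1 : (z : ℝ) < w + 1 := by linarith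
    have e2 : (w : ℝ) < z + 1 := by linarith
    norm_cast at e1 e2
    omega
  have hT : ofDigits (fun i => d (i + n)) = y := by
    rw [hw, hzw] at hy
    linarith
  have hstep := mul_ofDigits_eq_head_add_tail (fun i => d (i + n))
  have hS0 := ofDigits_nonneg (fun i => d (i + 1 + n))
  have hS1 := ofDigits_le_one (fun i => d (i + 1 + n))
  rw [hT] at hstep
  simp only [zero_add] at hstep
  have e1 : (a : ℝ) < (d n : ℕ) + 1 := by linarith
  have e2 : ((d n : ℕ) : ℝ) < a + 1 := by linarith
  norm_cast at e1 e2
  have : a = d n := by omega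
  exact this ▸ hd n

theorem exists_eq_mul_isCoprime (s : ℤ) (n : ℕ) (hn : n ≠ 0) :
    ∃ m h : ℤ, (n : ℤ) = m * h ∧ IsCoprime h s := by
  induction n using Nat.strong_induction_on with
  | _ n ih =>
    by_cases h : IsCoprime (n : ℤ) s
    · exact ⟨1, n, by simp, h⟩
    · rw [Int.isCoprime_iff_gcd_eq_one] at h
      obtain ⟨k, hk⟩ : Int.gcd n s ∣ n := by exact_mod_cast Int.gcd_dvd_left (n : ℤ) s
      have hk0 : k ≠ 0 := by rintro rfl; simp at hk; exact hn hk
      have hg0 : Int.gcd n s ≠ 0 := by intro h0; rw [h0] at hk; simp at hk; exact hn hk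
      have hkn : k < n := by
        have : 2 ≤ Int.gcd n s := by omega
        nlinarith [Nat.pos_of_ne_zero hk0]
      obtain ⟨m, h', e, hc⟩ := ih k hkn hk0
      refine ⟨Int.gcd n s * m, h', ?_, hc⟩
      rw [mul_assoc, ← e]
      exact_mod_cast hk

theorem exists_one_add_mul_pow_eq (s : ℕ) {M h : ℤ} (hM : (s : ℤ) ^ 2 ∣ M)
    (hh : IsCoprime h s) (i : ℕ) :
    ∃ h' : ℤ, IsCoprime h' s ∧ (1 + M * h) ^ (s ^ i) = 1 + M * s ^ i * h' := by
  induction i with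
  | zero => exact ⟨h, hh, by simp⟩
  | succ i ih =>
    obtain ⟨h', hc, e⟩ := ih
    obtain ⟨N, rfl⟩ := hM
    obtain ⟨k, hk⟩ := Polynomial.powAddExpansion (1 : ℤ) ((s : ℤ) ^ 2 * N * s ^ i * h') s
    refine ⟨h' + s * (k * N * s ^ i * h' ^ 2), ?_, ?_⟩
    · exact IsCoprime.add_mul_left_left hc _
    · rw [pow_succ s, pow_mul, e, hk]
      simp
      ring

/-- The powers of `1 + M * h` fill the whole residue class of `1` modulo `M`, `s`-adically. -/
theorem exists_pow_sub_dvd {s : ℕ} (hs : 0 < s) {M h : ℤ} (hM : (s : ℤ) ^ 2 ∣ M)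
    (hh : IsCoprime h s) (t : ℤ) (i : ℕ) :
    ∃ n : ℕ, M * s ^ i ∣ (1 + M * h) ^ n - (1 + M * t) := by
  induction i with
  | zero => exact ⟨0, -t, by simp⟩
  | succ i ih =>
    obtain ⟨n, w, hw⟩ := ih
    obtain ⟨h', hc, e⟩ := exists_one_add_mul_pow_eq s hM hh i
    have hg : IsCoprime ((1 + M * h) ^ n) (s : ℤ) := by
      obtain ⟨N, rfl⟩ := hM
      refine IsCoprime.pow_left ?_
      rw [show 1 + (s : ℤ) ^ 2 * N * h = 1 + s * (s * N * h) by ring]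
      exact IsCoprime.add_mul_left_left isCoprime_one_left _
    obtain ⟨u, v, huv⟩ := hc.mul_left hg
    -- The exponent must be a natural number, so a representative modulo `s` is used.
    obtain ⟨y, r, hyr⟩ : ∃ (y : ℕ) (r : ℤ), (y : ℤ) = -w * u + s * r := by
      refine ⟨(-w * u + s * |w * u|).toNat, |w * u|, Int.toNat_of_nonneg ?_⟩
      have h1 : w * u ≤ |w * u| := le_abs_self _
      have h2 := abs_nonneg (w * u)
      have : (1 : ℤ) ≤ s := by exact_mod_cast hs
      nlinarith
    obtain ⟨k, hk⟩ := Polynomial.powAddExpansion (1 : ℤ) (M * s ^ i * h') y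
    obtain ⟨N, hN⟩ := hM
    refine ⟨n + s ^ i * y, w * v + (1 + M * h) ^ n * (h' * r + k * s ^ i * s * N * h' ^ 2), ?_⟩
    rw [pow_add, pow_mul, e, hk, hyr, pow_succ (s : ℤ) i]
    generalize (1 + M * h) ^ n = G at *
    simp only [one_pow]
    linear_combination hw - M * s ^ i * w * huv + M * s ^ i * G * k * s ^ i * h' ^ 2 * hN

/-- The orbit of `1 / s ^ k` under multiplication by `q` modulo `1` meets the interior of every
cylinder of length one, once `k` is large. -/
theorem exists_forall_exists_pow_mul_eq {q s : ℕ} (hq : 1 < q) (hs : 1 < s) (hqs : q.Coprime s)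
    (a : ℕ) :
    ∃ k₀ : ℕ, ∀ k ≥ k₀, ∃ (n : ℕ) (z u : ℤ), (q : ℤ) ^ n = s ^ k * z + u ∧
      (a : ℤ) * s ^ k < q * u ∧ (q : ℤ) * u < (a + 1) * s ^ k := by
  obtain ⟨N, hN0, M, h, hg, hM, hM0, hh⟩ : ∃ (N : ℕ) (_ : 0 < N) (M h : ℤ),
      (q : ℤ) ^ N = 1 + M * h ∧ (s : ℤ) ^ 2 ∣ M ∧ 0 < M ∧ IsCoprime h s := by
    have hN0 : 0 < (s ^ 2).totient := Nat.totient_pos.mpr (by positivity)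
    obtain ⟨c, hc⟩ := (Nat.modEq_iff_dvd' (Nat.one_le_pow _ _ hq.le)).mp
      (Nat.ModEq.pow_totient (hqs.pow_right 2)).symm
    have hpow : q ^ (s ^ 2).totient = 1 + s ^ 2 * c := by
      have := Nat.one_le_pow (s ^ 2).totient q hq.le
      omega
    have hc0 : c ≠ 0 := by
      rintro rfl
      have := Nat.one_lt_pow hN0.ne' hq
      omega
    obtain ⟨m, h, hmh, hh⟩ := exists_eq_mul_isCoprime s c hc0
    have hm0 : m ≠ 0 := by
      rintro rfl
      simp at hmh
      exact hc0 hmh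
    have hs2 : (0 : ℤ) < (s : ℤ) ^ 2 := by positivity
    have hpowZ : (q : ℤ) ^ (s ^ 2).totient = 1 + s ^ 2 * (m * h) := by
      rw [← hmh]
      exact_mod_cast hpow
    refine ⟨_, hN0, s ^ 2 * |m|, m.sign * h, ?_, dvd_mul_right _ _,
      mul_pos hs2 (abs_pos.mpr hm0), ?_⟩
    · rw [hpowZ]
      linear_combination -(s : ℤ) ^ 2 * h * Int.sign_mul_abs m
    · rcases hm0.lt_or_gt with hm | hm
      · rw [Int.sign_eq_neg_one_of_neg hm, neg_one_mul]
        exact hh.neg_left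
      · rwa [Int.sign_eq_one_of_pos hm, one_mul]
  refine ⟨(q * M + q).toNat, fun k hk => ?_⟩
  have hqZ : (0 : ℤ) < q := by exact_mod_cast hq.le
  have hqM : 0 < q * M := mul_pos hqZ hM0
  have hks : q * M + q < (s : ℤ) ^ k := by
    have h1 : k < s ^ k := Nat.lt_pow_self hs
    have h2 : (k : ℤ) < (s : ℤ) ^ k := by exact_mod_cast h1
    have h3 := Int.self_le_toNat (q * M + q)
    omega
  set t : ℤ := a * s ^ k / (q * M) + 1
  obtain ⟨n, hn⟩ := exists_pow_sub_dvd (zero_lt_one.trans hs) hM hh t k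
  obtain ⟨z, hz⟩ := (Dvd.intro_left M rfl : (s : ℤ) ^ k ∣ M * s ^ k).trans hn
  have h1 := Int.lt_mul_ediv_self_add (x := a * s ^ k) hqM
  have h2 := Int.mul_ediv_self_le (x := a * s ^ k) hqM.ne'
  refine ⟨N * n, z, 1 + M * t, ?_, ?_, ?_⟩
  · rw [pow_mul, hg]
    linear_combination hz
  · simp only [t]
    nlinarith
  · simp only [t]
    nlinarith

theorem inv_pow_not_mem_K {q s : ℕ} (hq : 1 < q) (hs : 1 < s) (hqs : q.Coprime s)
    {A : Finset ℕ} (hAq : A ⊆ Finset.range q) (hA : A.card < q) (m : ℕ) :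
    ∃ k₀ : ℕ, ∀ k ≥ k₀, (((q ^ m * s : ℕ) : ℝ) ^ k)⁻¹ ∉ K q A := by
  obtain ⟨a, ha, haA⟩ := Finset.exists_mem_notMem_of_card_lt_card
    (hA.trans_eq (Finset.card_range q).symm)
  obtain ⟨k₀, hk₀⟩ := exists_forall_exists_pow_mul_eq hq hs hqs a
  refine ⟨k₀, fun k hk hx => haA ?_⟩
  obtain ⟨n, z, u, hz, h1, h2⟩ := hk₀ k hk
  have hq0 : (q : ℝ) ≠ 0 := by exact_mod_cast (zero_lt_one.trans hq).ne'
  have hs0 : (0 : ℝ) < (s : ℝ) ^ k := by positivity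
  have hzR : (q : ℝ) ^ n = s ^ k * z + u := by exact_mod_cast hz
  have h1R : (a : ℝ) * s ^ k < q * u := by exact_mod_cast h1
  have h2R : (q : ℝ) * u < (a + 1) * s ^ k := by exact_mod_cast h2
  refine mem_of_mem_K_of_lt_of_lt hAq hx (n := m * k + n) (z := z) (y := u / s ^ k) ?_
    (Finset.mem_range.mp ha) ?_ ?_
  · push_cast
    rw [mul_pow, ← pow_mul, pow_add, hzR]
    field_simp
  · rw [← mul_div_assoc, lt_div_iff₀ hs0]
    exact h1R
  · rw [← mul_div_assoc, div_lt_iff₀ hs0]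
    exact h2R

theorem B_eq_insert_range {p : ℕ} (hp : 2 ≤ p) :
    B p = insert 0 (Set.range fun k : ℕ => ((p : ℝ) ^ (k + 1))⁻¹) := by
  have hset : {x : ℝ | ∃ k : ℕ, 0 < k ∧ x = ((p : ℝ) ^ k)⁻¹} =
      Set.range fun k : ℕ => ((p : ℝ) ^ (k + 1))⁻¹ := by
    ext x
    constructor
    · rintro ⟨k, hk, rfl⟩
      exact ⟨k - 1, by simp [Nat.sub_add_cancel hk]⟩
    · rintro ⟨k, rfl⟩
      exact ⟨k + 1, k.succ_pos, rfl⟩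
  have hlim : Filter.Tendsto (fun k : ℕ => ((p : ℝ) ^ (k + 1))⁻¹) Filter.atTop (nhds 0) :=
    tendsto_inv_atTop_zero.comp ((tendsto_pow_atTop_atTop_of_one_lt
      (by exact_mod_cast hp)).comp (Filter.tendsto_add_atTop_nat 1))
  rw [B, hset]
  refine (closure_minimal (Set.subset_insert _ _) hlim.isCompact_insert_range.isClosed).antisymm
    (Set.insert_subset ?_ subset_closure)
  exact mem_closure_of_tendsto hlim (Filter.Eventually.of_forall Set.mem_range_self)

theorem inv_pow_mem_K {q : ℕ} (hq : 3 ≤ q) {A : Finset ℕ}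
    (hA : ({0, 1} : Finset ℕ) ⊆ A ∨ ({0, q - 1} : Finset ℕ) ⊆ A) (n : ℕ) :
    ((q : ℝ) ^ (n + 1))⁻¹ ∈ K q A := by
  have hq0 : (q : ℝ) ≠ 0 := by positivity
  rcases hA with hA | hA
  · refine ⟨fun i => if i = n then 1 else 0, fun i => hA ?_, ?_⟩
    · dsimp only
      split_ifs <;> simp
    · rw [tsum_eq_single n fun i hi => by simp [hi]]
      simp
  · refine ⟨fun i => if i < n + 1 then 0 else q - 1, fun i => hA ?_, ?_⟩
    · dsimp only
      split_ifs <;> simp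
    · have hone := Real.ofDigits_const_last_eq_one' (b := q) (by omega)
      have hsum := Real.ofDigits_eq_sum_add_ofDigits (b := q)
        (fun i => if i < n + 1 then ⟨0, by omega⟩ else ⟨q - 1, by omega⟩) (n + 1)
      simp only [not_lt.mpr (Nat.le_add_left (n + 1) _), if_false, hone, mul_one] at hsum
      rw [Finset.sum_eq_zero fun i hi => by
        simp [Real.ofDigitsTerm, Finset.mem_range.mp hi], zero_add] at hsum
      rw [← hsum, Real.ofDigits]
      refine tsum_congr fun i => ?_
      simp only [Real.ofDigitsTerm, div_eq_mul_inv]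
      split_ifs <;> rfl

theorem irrational_log_div_log {q s m : ℕ} (hq : 1 < q) (hs : 1 < s) (hqs : q.Coprime s) :
    Irrational (Real.log (q ^ m * s : ℕ) / Real.log q) := by
  rintro ⟨r, hr⟩
  have hlogq : 0 < Real.log q := Real.log_pos (by exact_mod_cast hq)
  have hp : 1 < q ^ m * s := hs.trans_le (Nat.le_mul_of_pos_left s (Nat.one_le_pow _ _ hq.le))
  have hlogp : 0 < Real.log (q ^ m * s : ℕ) := Real.log_pos (by exact_mod_cast hp)
  have hr0 : 0 < r := by
    have : (0 : ℝ) < r := hr ▸ div_pos hlogp hlogq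
    exact_mod_cast this
  obtain ⟨a, ha⟩ := Int.eq_ofNat_of_zero_le (Rat.num_pos.mpr hr0).le
  have hlog : r.den * Real.log (q ^ m * s : ℕ) = a * Real.log q := by
    have hden : (r.den : ℝ) ≠ 0 := by exact_mod_cast r.den_ne_zero
    rw [Rat.cast_def, ha, div_eq_div_iff hden hlogq.ne'] at hr
    push_cast at hr ⊢
    linarith
  rw [← Real.log_pow, ← Real.log_pow] at hlog
  have hpow := Real.log_injOn_pos (Set.mem_Ioi.mpr (by positivity))
    (Set.mem_Ioi.mpr (by positivity)) hlog
  have hpowN : (q ^ m * s) ^ r.den = q ^ a := by exact_mod_cast hpow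
  have hdvd : s ∣ q ^ a :=
    ((dvd_mul_left s (q ^ m)).trans (dvd_pow_self _ r.den_ne_zero)).trans hpowN.dvd
  exact hs.ne' (Nat.eq_one_of_dvd_coprimes (hqs.pow_left a) hdvd dvd_rfl)

theorem stmt_17 (q : ℕ) (hq : 3 ≤ q) (hqp : q.Prime)
    (A : Finset ℕ) (hAq : A ⊆ Finset.range q) (hA1 : 1 < A.card) (hA2 : A.card < q)
    (hA : ({0, 1} : Finset ℕ) ⊆ A ∨ ({0, q - 1} : Finset ℕ) ⊆ A)
    (p : ℕ) (hp : 2 ≤ p) :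
    (B p ∩ K q A).Finite ↔ Irrational (Real.log p / Real.log q) := by
  have hq1 : 1 < q := hqp.one_lt
  obtain ⟨m, s, hs, rfl⟩ :=
    Nat.exists_eq_pow_mul_and_not_dvd (n := p) (by omega) q hqp.ne_one
  have hs0 : s ≠ 0 := by
    rintro rfl
    simp at hs
  rw [B_eq_insert_range hp]
  rcases (show 1 ≤ s by omega).eq_or_lt with rfl | hs1
  · have hlog : Real.log q ≠ 0 := (Real.log_pos (by exact_mod_cast hq1)).ne'
    refine iff_of_false (fun hfin => ?_) ?_
    · refine Set.infinite_range_of_injective (f := fun k : ℕ => (((q ^ m * 1 : ℕ) : ℝ) ^ (k + 1))⁻¹)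
        (fun i j hij => ?_) (hfin.subset ?_)
      · have := Nat.pow_right_injective hp (a₁ := i + 1) (a₂ := j + 1)
          (by exact_mod_cast inv_injective hij)
        omega
      · rintro _ ⟨k, rfl⟩
        refine ⟨Or.inr ⟨k, rfl⟩, ?_⟩
        have hm : m ≠ 0 := by
          rintro rfl
          simp at hp
        obtain ⟨n, hn⟩ := Nat.exists_eq_succ_of_ne_zero (Nat.mul_ne_zero hm k.succ_ne_zero)
        have := inv_pow_mem_K hq hA n
        rw [← Nat.succ_eq_add_one n, ← hn, pow_mul] at this
        simpa using this
    · rw [Irrational, not_not]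
      exact ⟨m, by simp [mul_div_cancel_right₀ _ hlog]⟩
  · have hqs : q.Coprime s := (Nat.Prime.coprime_iff_not_dvd hqp).mpr hs
    refine iff_of_true ?_ (irrational_log_div_log hq1 hs1 hqs)
    obtain ⟨k₀, hk₀⟩ := inv_pow_not_mem_K hq1 hs1 hqs hAq hA2 m
    refine (((Set.finite_Iio k₀).image
      fun k : ℕ => (((q ^ m * s : ℕ) : ℝ) ^ (k + 1))⁻¹).insert 0).subset ?_
    rintro x ⟨rfl | ⟨k, rfl⟩, hx⟩
    · exact Set.mem_insert _ _
    · refine Or.inr ⟨k, ?_, rfl⟩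
      by_contra hk
      exact hk₀ (k + 1) (by simp at hk; omega) hx
end
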